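/- arXiv:1401.0705 — 3 statements merged into one kernel-verified Lean document; each statement's English description precedes it below -/
import Mathlib

section
/- Let M be a d-tape automaton on alphabet A = A₁ × ⋯ × A_d in which every state has at least one outgoing transition. For each state q let Y_q = {Δ(c) ∈ ℝ^d : c ∈ A^ℕ is q-accepted by M}. Then each Y_q is a nonempty compact subset of [0,1]^d, and the family satisfies the graph-directed fixed-point equations Y_q = ⋃ over all transitions R = (q, r, (w₁,…,w_d)) of M of f_R(Y_r), where f_R(x) = diag(|A₁|^{−|w₁|},…,|A_d|^{−|w_d|}) · x + Δ(w₁,…,w_d). Consequently (Y_q)_q is the family of attractors of the GIFS associated with M. -/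
/-- `ConcatEq w s` : the infinite concatenation `w 0 ++ w 1 ++ ⋯` equals the
infinite sequence `s`. -/
def ConcatEq {α : Type*} (w : ℕ → List α) (s : ℕ → α) : Prop :=
  ∀ (n : ℕ) (j : Fin (w n).length),
    s (((Finset.range n).sum fun i => (w i).length) + (j : ℕ)) = (w n).get j

/-- The configuration `c` is `q`-accepted by the `d`-tape automaton with state type `Q`,
tape alphabets `A k` and transition set `T`. -/
def AcceptsD {d : ℕ} {Q : Type*} {A : Fin d → Type*}
    (T : Set (Q × Q × ((k : Fin d) → List (A k)))) (q : Q)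
    (c : ℕ → (k : Fin d) → A k) : Prop :=
  ∃ t : ℕ → Q × Q × ((k : Fin d) → List (A k)),
    (∀ n, t n ∈ T) ∧ (t 0).1 = q ∧ (∀ n, (t n).2.1 = (t (n + 1)).1) ∧
    ∀ k : Fin d, ConcatEq (fun n => (t n).2.2 k) (fun i => c i k)

/-- `Δ_k` of an infinite word: `Σ_{i≥1} δ(u_i)·|A_k|^{-i}`. -/
noncomputable def deltaInf {α : Type*} [Fintype α] (δ : α ≃ Fin (Fintype.card α))
    (s : ℕ → α) : ℝ :=
  ∑' i : ℕ, ((δ (s i) : ℕ) : ℝ) / (Fintype.card α : ℝ) ^ (i + 1)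

/-- `Δ_k` of a finite word: `Σ_{1 ≤ i ≤ |w|} δ(w_i)·|A_k|^{-i}`. -/
noncomputable def deltaFin {α : Type*} [Fintype α] (δ : α ≃ Fin (Fintype.card α))
    (w : List α) : ℝ :=
  ∑ i : Fin w.length, ((δ (w.get i) : ℕ) : ℝ) / (Fintype.card α : ℝ) ^ ((i : ℕ) + 1)

/-- `Δ(c) ∈ [0,1]^d` of a configuration `c`. -/
noncomputable def DeltaC {d : ℕ} {A : Fin d → Type*} [∀ k, Fintype (A k)]
    (δ : (k : Fin d) → A k ≃ Fin (Fintype.card (A k)))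
    (c : ℕ → (k : Fin d) → A k) : EuclideanSpace ℝ (Fin d) :=
  (WithLp.equiv 2 ((k : Fin d) → ℝ)).symm fun k => deltaInf (δ k) fun i => c i k

/-- `Y_q = { Δ(c) : c is q-accepted }`. -/
noncomputable def Yset {d : ℕ} {Q : Type*} {A : Fin d → Type*} [∀ k, Fintype (A k)]
    (δ : (k : Fin d) → A k ≃ Fin (Fintype.card (A k)))
    (T : Set (Q × Q × ((k : Fin d) → List (A k)))) (q : Q) :
    Set (EuclideanSpace ℝ (Fin d)) :=
  {x | ∃ c : ℕ → (k : Fin d) → A k, AcceptsD T q c ∧ x = DeltaC δ c}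

/-- The contracting affine map `f_R` associated with a transition labelled by the
tuple of words `w`: `f_R(x) = diag(|A₁|^{-|w₁|},…,|A_d|^{-|w_d|}) x + Δ(w₁,…,w_d)`. -/
noncomputable def fR {d : ℕ} {A : Fin d → Type*} [∀ k, Fintype (A k)]
    (δ : (k : Fin d) → A k ≃ Fin (Fintype.card (A k)))
    (w : (k : Fin d) → List (A k)) :
    EuclideanSpace ℝ (Fin d) → EuclideanSpace ℝ (Fin d) :=
  fun x => (WithLp.equiv 2 ((k : Fin d) → ℝ)).symm
    fun k => x k / (Fintype.card (A k) : ℝ) ^ (w k).length + deltaFin (δ k) (w k)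

/-! ### Infinite concatenations -/

/-- The concatenation of the first `n` words of `w`. -/
def concatPrefix {α : Type*} (w : ℕ → List α) : ℕ → List α
  | 0 => []
  | n + 1 => concatPrefix w n ++ w n

/-- The infinite concatenation of a sequence of nonempty words
(with a default letter `a`, irrelevant when all words are nonempty). -/
def infConcat {α : Type*} (a : α) (w : ℕ → List α) (i : ℕ) : α :=
  (concatPrefix w (i + 1))[i]?.getD a

theorem length_concatPrefix {α : Type*} (w : ℕ → List α) (n : ℕ) :
    (concatPrefix w n).length = (Finset.range n).sum fun i => (w i).length := by
  induction n with
  | zero => simp [concatPrefix]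
  | succ n ih => simp [concatPrefix, Finset.sum_range_succ, ih]

theorem le_length_concatPrefix {α : Type*} {w : ℕ → List α} (hw : ∀ n, w n ≠ []) (n : ℕ) :
    n ≤ (concatPrefix w n).length := by
  induction n with
  | zero => simp
  | succ n ih =>
    have := List.length_pos_iff.2 (hw n)
    simp only [concatPrefix, List.length_append]
    omega

theorem concatPrefix_mono {α : Type*} (w : ℕ → List α) {m n : ℕ} (h : m ≤ n) :
    concatPrefix w m <+: concatPrefix w n := by
  induction n, h using Nat.le_induction with
  | base => exact List.prefix_rfl
  | succ n _ ih => exact ih.trans (List.prefix_append _ _)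

theorem infConcat_eq_getElem {α : Type*} (a : α) {w : ℕ → List α} (hw : ∀ n, w n ≠ [])
    {n i : ℕ} (hi : i < (concatPrefix w n).length) :
    infConcat a w i = (concatPrefix w n)[i] := by
  have hi' : i < (concatPrefix w (i + 1)).length := le_length_concatPrefix hw (i + 1)
  rw [infConcat, List.getElem?_eq_getElem hi', Option.getD_some]
  rcases le_total (i + 1) n with h | h
  · exact (concatPrefix_mono w h).getElem hi'
  · exact ((concatPrefix_mono w h).getElem hi).symm

theorem concatEq_infConcat {α : Type*} (a : α) {w : ℕ → List α} (hw : ∀ n, w n ≠ []) :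
    ConcatEq w (infConcat a w) := by
  intro n j
  have hj : (concatPrefix w n).length + (j : ℕ) < (concatPrefix w (n + 1)).length := by
    simp [concatPrefix]
  rw [← length_concatPrefix, infConcat_eq_getElem a hw hj]
  simp [concatPrefix]

theorem ConcatEq.getElem_concatPrefix {α : Type*} {w : ℕ → List α} {s : ℕ → α}
    (h : ConcatEq w s) (n i : ℕ) (hi : i < (concatPrefix w n).length) :
    (concatPrefix w n)[i] = s i := by
  induction n generalizing i with
  | zero => simp [concatPrefix] at hi
  | succ n ih =>
    simp only [concatPrefix, List.length_append] at hi
    simp only [concatPrefix, List.getElem_append]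
    split_ifs with hlt
    · exact ih i hlt
    · have := h n ⟨i - (concatPrefix w n).length, by omega⟩
      rw [← length_concatPrefix] at this
      simp only [List.get_eq_getElem] at this
      rw [← this]
      congr 1
      omega

theorem ConcatEq.eq_infConcat {α : Type*} (a : α) {w : ℕ → List α} (hw : ∀ n, w n ≠ [])
    {s : ℕ → α} (h : ConcatEq w s) : s = infConcat a w := by
  funext i
  have hi : i < (concatPrefix w (i + 1)).length := le_length_concatPrefix hw (i + 1)
  rw [infConcat_eq_getElem a hw hi, h.getElem_concatPrefix]

theorem concatEq_iff_head_tail {α : Type*} {w : ℕ → List α} {s : ℕ → α} :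
    ConcatEq w s ↔ (∀ j : Fin (w 0).length, s j = (w 0).get j) ∧
      ConcatEq (fun n => w (n + 1)) (fun i => s ((w 0).length + i)) := by
  have key : ∀ n j : ℕ, ((Finset.range (n + 1)).sum fun i => (w i).length) + j =
      (w 0).length + (((Finset.range n).sum fun i => (w (i + 1)).length) + j) := by
    intro n j
    rw [Finset.sum_range_succ']
    ring
  constructor
  · intro h
    refine ⟨fun j => by simpa using h 0 j, fun n j => ?_⟩
    rw [← h (n + 1) j, key]
  · rintro ⟨h0, h⟩ n j
    cases n with
    | zero => simpa using h0 j
    | succ n => rw [key]; exact h n j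

/-! ### The expansion map on one tape -/

section Delta

variable {α : Type*} [Fintype α]

theorem hasSum_card_sub_one_div_pow (hα : 1 < Fintype.card α) :
    HasSum (fun i : ℕ => ((Fintype.card α : ℝ) - 1) / (Fintype.card α : ℝ) ^ (i + 1)) 1 := by
  have hN : (1 : ℝ) < Fintype.card α := by exact_mod_cast hα
  have hN1 : (Fintype.card α : ℝ) - 1 ≠ 0 := by linarith
  have h := (hasSum_geometric_of_lt_one (r := (Fintype.card α : ℝ)⁻¹) (by positivity)
    (inv_lt_one_of_one_lt₀ hN)).mul_left (((Fintype.card α : ℝ) - 1) / Fintype.card α)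
  have hterm : (fun i : ℕ => ((Fintype.card α : ℝ) - 1) / (Fintype.card α : ℝ) ^ (i + 1)) =
      fun i => ((Fintype.card α : ℝ) - 1) / Fintype.card α * (Fintype.card α : ℝ)⁻¹ ^ i := by
    funext i
    rw [pow_succ, inv_pow]
    field_simp
  have hval : ((Fintype.card α : ℝ) - 1) / Fintype.card α *
      (1 - (Fintype.card α : ℝ)⁻¹)⁻¹ = 1 := by
    field_simp
  rw [hval] at h
  rwa [hterm]

theorem digit_div_pow_le (hα : 1 < Fintype.card α) (δ : α ≃ Fin (Fintype.card α))
    (a : α) (i : ℕ) :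
    ((δ a : ℕ) : ℝ) / (Fintype.card α : ℝ) ^ (i + 1) ≤
      ((Fintype.card α : ℝ) - 1) / (Fintype.card α : ℝ) ^ (i + 1) := by
  have h : ((δ a : ℕ) : ℝ) + 1 ≤ Fintype.card α := by exact_mod_cast (δ a).isLt
  gcongr
  linarith

theorem summable_digit_div_pow (hα : 1 < Fintype.card α) (δ : α ≃ Fin (Fintype.card α))
    (s : ℕ → α) :
    Summable fun i : ℕ => ((δ (s i) : ℕ) : ℝ) / (Fintype.card α : ℝ) ^ (i + 1) :=
  Summable.of_nonneg_of_le (fun _ => by positivity) (fun i => digit_div_pow_le hα δ (s i) i)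
    (hasSum_card_sub_one_div_pow hα).summable

theorem deltaInf_mem_Icc (hα : 1 < Fintype.card α) (δ : α ≃ Fin (Fintype.card α))
    (s : ℕ → α) : deltaInf δ s ∈ Set.Icc (0 : ℝ) 1 :=
  ⟨tsum_nonneg fun _ => by positivity,
    hasSum_le (fun i => digit_div_pow_le hα δ (s i) i) (summable_digit_div_pow hα δ s).hasSum
      (hasSum_card_sub_one_div_pow hα)⟩

theorem deltaInf_eq_of_head_eq (hα : 1 < Fintype.card α) (δ : α ≃ Fin (Fintype.card α))
    {w : List α} {s : ℕ → α} (h : ∀ j : Fin w.length, s j = w.get j) :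
    deltaInf δ s = deltaInf δ (fun i => s (w.length + i)) / (Fintype.card α : ℝ) ^ w.length +
      deltaFin δ w := by
  have hfin : deltaFin δ w = ∑ i ∈ Finset.range w.length,
      ((δ (s i) : ℕ) : ℝ) / (Fintype.card α : ℝ) ^ (i + 1) := by
    rw [Finset.sum_range]
    exact Finset.sum_congr rfl fun i _ => by rw [h i]
  rw [deltaInf, ← (summable_digit_div_pow hα δ s).sum_add_tsum_nat_add w.length, hfin,
    deltaInf, ← tsum_div_const, add_comm]
  congr 1
  refine tsum_congr fun i => ?_
  rw [div_div, ← pow_add, add_comm i, add_assoc, add_comm w.length (i + 1),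
    add_comm w.length i]

theorem continuous_deltaInf_infConcat (hα : 1 < Fintype.card α)
    (δ : α ≃ Fin (Fintype.card α)) (a : α) {V : Type*} [TopologicalSpace V]
    [DiscreteTopology V] (f : V → List α) :
    Continuous fun t : ℕ → V => deltaInf δ (infConcat a fun n => f (t n)) := by
  have hpre : ∀ n, IsLocallyConstant fun t : ℕ → V => concatPrefix (fun n => f (t n)) n := by
    intro n
    induction n with
    | zero => exact IsLocallyConstant.const []
    | succ n ih =>
      exact ih.comp₂ ((IsLocallyConstant.of_discrete f).comp_continuous (continuous_apply n))
        (fun u v => u ++ v)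
  refine continuous_tsum (fun i => ?_) (hasSum_card_sub_one_div_pow hα).summable
    fun i t => ?_
  · exact ((hpre (i + 1)).comp fun u =>
      ((δ (u[i]?.getD a) : ℕ) : ℝ) / (Fintype.card α : ℝ) ^ (i + 1)).continuous
  · rw [Real.norm_of_nonneg (by positivity)]
    exact digit_div_pow_le hα δ _ i

end Delta

/-! ### The sets `Y_q` -/

section Automaton

variable {d : ℕ} {Q : Type*} {A : Fin d → Type*}

/-- `t` is an infinite sequence of consecutive transitions in `T` starting from `q`. -/
def IsRun (T : Set (Q × Q × ((k : Fin d) → List (A k)))) (q : Q)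
    (t : ℕ → Q × Q × ((k : Fin d) → List (A k))) : Prop :=
  (∀ n, t n ∈ T) ∧ (t 0).1 = q ∧ ∀ n, (t n).2.1 = (t (n + 1)).1

theorem exists_isRun {T : Set (Q × Q × ((k : Fin d) → List (A k)))}
    (hout : ∀ q : Q, ∃ t ∈ T, t.1 = q) (q : Q) : ∃ t, IsRun T q t := by
  choose e heT he using hout
  let g : ℕ → Q := fun n => (fun r => (e r).2.1)^[n] q
  refine ⟨fun n => e (g n), fun n => heT _, he _, fun n => ?_⟩
  rw [he]
  exact (Function.iterate_succ_apply' (fun r => (e r).2.1) n q).symm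

variable [∀ k, Fintype (A k)] (δ : (k : Fin d) → A k ≃ Fin (Fintype.card (A k)))

theorem mem_Yset_iff {T : Set (Q × Q × ((k : Fin d) → List (A k)))}
    (hne : ∀ t ∈ T, ∀ k : Fin d, t.2.2 k ≠ []) (a : (k : Fin d) → A k) (q : Q)
    (x : EuclideanSpace ℝ (Fin d)) :
    x ∈ Yset δ T q ↔ ∃ t, IsRun T q t ∧
      DeltaC δ (fun i k => infConcat (a k) (fun n => (t n).2.2 k) i) = x := by
  constructor
  · rintro ⟨c, ⟨t, htT, h0, hstep, hc⟩, rfl⟩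
    refine ⟨t, ⟨htT, h0, hstep⟩, ?_⟩
    congr 1
    funext i k
    exact (congrFun ((hc k).eq_infConcat (a k) fun n => hne _ (htT n) k) i).symm
  · rintro ⟨t, ⟨htT, h0, hstep⟩, rfl⟩
    exact ⟨_, ⟨t, htT, h0, hstep, fun k =>
      concatEq_infConcat (a k) fun n => hne _ (htT n) k⟩, rfl⟩

theorem Yset_nonempty {T : Set (Q × Q × ((k : Fin d) → List (A k)))}
    (hA : ∀ k, 1 < Fintype.card (A k)) (hne : ∀ t ∈ T, ∀ k : Fin d, t.2.2 k ≠ [])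
    (hout : ∀ q : Q, ∃ t ∈ T, t.1 = q) (q : Q) : (Yset δ T q).Nonempty := by
  have a : ∀ k, A k := fun k => (δ k).symm ⟨0, by have := hA k; omega⟩
  obtain ⟨t, ht⟩ := exists_isRun hout q
  exact ⟨_, (mem_Yset_iff δ hne a q _).2 ⟨t, ht, rfl⟩⟩

theorem isCompact_Yset {T : Set (Q × Q × ((k : Fin d) → List (A k)))}
    (hA : ∀ k, 1 < Fintype.card (A k)) (hT : T.Finite)
    (hne : ∀ t ∈ T, ∀ k : Fin d, t.2.2 k ≠ []) (q : Q) : IsCompact (Yset δ T q) := by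
  have a : ∀ k, A k := fun k => (δ k).symm ⟨0, by have := hA k; omega⟩
  have : Finite T := hT
  let _ : TopologicalSpace T := ⊥
  have : DiscreteTopology T := ⟨rfl⟩
  let π : (ℕ → T) → EuclideanSpace ℝ (Fin d) := fun t =>
    DeltaC δ (fun i k => infConcat (a k) (fun n => (t n).1.2.2 k) i)
  have hπ : Continuous π := by
    refine (PiLp.continuous_toLp 2 _).comp (continuous_pi fun k => ?_)
    exact continuous_deltaInf_infConcat (hA k) (δ k) (a k) fun t : T => t.1.2.2 k
  have hclosed : IsClosed {t : ℕ → T | IsRun T q fun n => (t n).1} := by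
    have h0 : IsClosed {t : ℕ → T | (t 0).1.1 = q} :=
      (isClosed_discrete {v : T | v.1.1 = q}).preimage
        (continuous_apply 0 : Continuous fun t : ℕ → T => t 0)
    have hstep : IsClosed {t : ℕ → T | ∀ n, (t n).1.2.1 = (t (n + 1)).1.1} := by
      rw [Set.ofPred_forall]
      exact isClosed_iInter fun n =>
        (isClosed_discrete {v : T × T | v.1.1.2.1 = v.2.1.1}).preimage
          ((continuous_apply n).prodMk (continuous_apply (n + 1)) :
            Continuous fun t : ℕ → T => (t n, t (n + 1)))
    convert h0.inter hstep using 1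
    ext t
    simp [IsRun]
  have himage : Yset δ T q = π '' {t : ℕ → T | IsRun T q fun n => (t n).1} := by
    ext x
    rw [mem_Yset_iff δ hne a]
    constructor
    · rintro ⟨t, ht, rfl⟩
      exact ⟨fun n => ⟨t n, ht.1 n⟩, ht, rfl⟩
    · rintro ⟨t, ht, rfl⟩
      exact ⟨_, ht, rfl⟩
  rw [himage]
  exact hclosed.isCompact.image hπ

theorem Yset_subset_cube (T : Set (Q × Q × ((k : Fin d) → List (A k))))
    (hA : ∀ k, 1 < Fintype.card (A k)) (q : Q) :
    Yset δ T q ⊆ {x | ∀ k, x k ∈ Set.Icc (0 : ℝ) 1} := by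
  rintro _ ⟨c, -, rfl⟩ k
  exact deltaInf_mem_Icc (hA k) (δ k) _

theorem DeltaC_eq_fR (hA : ∀ k, 1 < Fintype.card (A k)) {w : (k : Fin d) → List (A k)}
    {c : ℕ → (k : Fin d) → A k} (h : ∀ k, ∀ j : Fin (w k).length, c j k = (w k).get j) :
    DeltaC δ c = fR δ w (DeltaC δ fun i k => c ((w k).length + i) k) := by
  ext k
  exact deltaInf_eq_of_head_eq (hA k) (δ k) (h k)

theorem Yset_eq_iUnion (T : Set (Q × Q × ((k : Fin d) → List (A k))))
    (hA : ∀ k, 1 < Fintype.card (A k)) (q : Q) :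
    Yset δ T q = ⋃ t ∈ T, ⋃ (_ : t.1 = q), fR δ t.2.2 '' Yset δ T t.2.1 := by
  ext x
  simp only [Set.mem_iUnion, exists_prop]
  constructor
  · rintro ⟨c, ⟨t, htT, h0, hstep, hc⟩, rfl⟩
    have hc' := fun k => concatEq_iff_head_tail.1 (hc k)
    refine ⟨t 0, htT 0, h0, _, ⟨fun i k => c (((t 0).2.2 k).length + i) k, ?_, rfl⟩,
      (DeltaC_eq_fR δ hA fun k => (hc' k).1).symm⟩
    exact ⟨fun n => t (n + 1), fun n => htT _, (hstep 0).symm, fun n => hstep _,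
      fun k => (hc' k).2⟩
  · rintro ⟨e, heT, rfl, _, ⟨c, ⟨t, htT, h0, hstep, hc⟩, rfl⟩, rfl⟩
    let c' : ℕ → (k : Fin d) → A k := fun i k =>
      if h : i < (e.2.2 k).length then (e.2.2 k)[i] else c (i - (e.2.2 k).length) k
    have hhead : ∀ k, ∀ j : Fin (e.2.2 k).length, c' j k = (e.2.2 k).get j := by
      intro k j
      simp [c']
    have htail : (fun i k => c' ((e.2.2 k).length + i) k) = c := by
      funext i k
      simp [c']
    refine ⟨c', ⟨fun n => Nat.casesOn n e t, ?_, rfl, ?_, fun k => ?_⟩, ?_⟩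
    · rintro (_ | n)
      exacts [heT, htT n]
    · rintro (_ | n)
      exacts [h0.symm, hstep n]
    · refine concatEq_iff_head_tail.2 ⟨hhead k, ?_⟩
      have := congrArg (fun (s : ℕ → (k : Fin d) → A k) i => s i k) htail
      exact (congrArg (ConcatEq _) this).mpr (hc k)
    · rw [DeltaC_eq_fR δ hA hhead, htail]

/-! ### Uniqueness of attractors -/

theorem dist_fR_le (hA : ∀ k, 1 < Fintype.card (A k)) {w : (k : Fin d) → List (A k)}
    (hw : ∀ k, w k ≠ []) (x y : EuclideanSpace ℝ (Fin d)) :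
    dist (fR δ w x) (fR δ w y) ≤ dist x y / 2 := by
  have hcoord : ∀ k, dist (fR δ w x k) (fR δ w y k) ≤ dist (x k) (y k) / 2 := by
    intro k
    have hN : (2 : ℝ) ≤ Fintype.card (A k) := by exact_mod_cast hA k
    have hpow : (2 : ℝ) ≤ (Fintype.card (A k) : ℝ) ^ (w k).length :=
      hN.trans (le_self_pow₀ (by linarith) (by simpa using hw k))
    have heq : fR δ w x k - fR δ w y k =
        (x k - y k) / (Fintype.card (A k) : ℝ) ^ (w k).length := by
      simp only [fR, WithLp.equiv_symm_apply]
      ring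
    rw [Real.dist_eq, Real.dist_eq, heq, abs_div, abs_of_pos (by linarith : (0 : ℝ) < _ ^ _)]
    gcongr
  have hsq : ∑ k, dist (fR δ w x k) (fR δ w y k) ^ 2 ≤ (dist x y / 2) ^ 2 := by
    rw [div_pow, EuclideanSpace.dist_eq, Real.sq_sqrt (by positivity), Finset.sum_div]
    refine Finset.sum_le_sum fun k _ => ?_
    rw [← div_pow]
    gcongr
    exact hcoord k
  rw [EuclideanSpace.dist_eq (fR δ w x)]
  exact Real.sqrt_le_iff.2 ⟨by positivity, hsq⟩

/-- A bounded family that is subinvariant under a contracting GIFS is contained in any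
superinvariant family of nonempty closed sets. -/
theorem subset_of_subinvariant_of_superinvariant [Finite Q]
    {T : Set (Q × Q × ((k : Fin d) → List (A k)))} (hA : ∀ k, 1 < Fintype.card (A k))
    (hne : ∀ t ∈ T, ∀ k : Fin d, t.2.2 k ≠ [])
    {X Y : Q → Set (EuclideanSpace ℝ (Fin d))}
    (hXb : ∀ q, Bornology.IsBounded (X q)) (hYb : ∀ q, Bornology.IsBounded (Y q))
    (hYn : ∀ q, (Y q).Nonempty) (hYc : ∀ q, IsClosed (Y q))
    (hX : ∀ q, X q ⊆ ⋃ t ∈ T, ⋃ (_ : t.1 = q), fR δ t.2.2 '' X t.2.1)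
    (hY : ∀ q, (⋃ t ∈ T, ⋃ (_ : t.1 = q), fR δ t.2.2 '' Y t.2.1) ⊆ Y q) (q : Q) :
    X q ⊆ Y q := by
  obtain ⟨B, hB⟩ := Metric.isBounded_iff.1
    ((Bornology.isBounded_iUnion.2 hXb).union (Bornology.isBounded_iUnion.2 hYb))
  have happrox : ∀ n : ℕ, ∀ q, ∀ x ∈ X q, ∃ y ∈ Y q, dist x y ≤ B * (1 / 2) ^ n := by
    intro n
    induction n with
    | zero =>
      intro q x hx
      obtain ⟨y, hy⟩ := hYn q
      refine ⟨y, hy, ?_⟩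
      simpa using hB (Or.inl (Set.mem_iUnion.2 ⟨q, hx⟩)) (Or.inr (Set.mem_iUnion.2 ⟨q, hy⟩))
    | succ n ih =>
      intro q x hx
      have hx' := hX q hx
      simp only [Set.mem_iUnion, exists_prop] at hx'
      obtain ⟨t, htT, rfl, x', hx', rfl⟩ := hx'
      obtain ⟨y', hy', hdist⟩ := ih _ x' hx'
      refine ⟨fR δ t.2.2 y', hY _ ?_, (dist_fR_le δ hA (hne t htT) x' y').trans ?_⟩
      · simp only [Set.mem_iUnion, exists_prop]
        exact ⟨t, htT, rfl, y', hy', rfl⟩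
      · rw [pow_succ]
        linarith
  intro x hx
  choose y hyY hy using fun n => happrox n q x hx
  have hlim : Filter.Tendsto (fun n : ℕ => B * (1 / 2 : ℝ) ^ n) Filter.atTop (nhds 0) := by
    simpa using (tendsto_pow_atTop_nhds_zero_of_lt_one (r := (1 / 2 : ℝ))
      (by norm_num) (by norm_num)).const_mul B
  refine (hYc q).mem_of_tendsto (f := y) (b := Filter.atTop) ?_ (Filter.Eventually.of_forall hyY)
  exact tendsto_iff_dist_tendsto_zero.2 (squeeze_zero (fun _ => dist_nonneg)
    (fun n => by rw [dist_comm]; exact hy n) hlim)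

end Automaton

/-- The sets `Y_q` are nonempty compact subsets of the unit cube, they satisfy the
graph-directed fixed-point equations of the GIFS associated with `M`, and they form
the unique such family: `(Y_q)_q` is the family of attractors of this GIFS. -/
theorem Yset_is_gifs_attractor {d : ℕ} {Q : Type*} [Fintype Q] {A : Fin d → Type*}
    [∀ k, Fintype (A k)] (hA : ∀ k, 1 < Fintype.card (A k))
    (δ : (k : Fin d) → A k ≃ Fin (Fintype.card (A k)))
    (T : Set (Q × Q × ((k : Fin d) → List (A k)))) (hT : T.Finite)
    (hne : ∀ t ∈ T, ∀ k : Fin d, t.2.2 k ≠ [])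
    (hout : ∀ q : Q, ∃ t ∈ T, t.1 = q) :
    (∀ q : Q, (Yset δ T q).Nonempty ∧ IsCompact (Yset δ T q) ∧
        Yset δ T q ⊆ {x | ∀ k, x k ∈ Set.Icc (0 : ℝ) 1}) ∧
    (∀ q : Q, Yset δ T q =
        ⋃ t ∈ T, ⋃ (_ : t.1 = q), fR δ t.2.2 '' Yset δ T t.2.1) ∧
    (∀ X : Q → Set (EuclideanSpace ℝ (Fin d)),
        (∀ q, (X q).Nonempty ∧ IsCompact (X q)) →
        (∀ q, X q = ⋃ t ∈ T, ⋃ (_ : t.1 = q), fR δ t.2.2 '' X t.2.1) →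
        X = Yset δ T) := by
  have hYc := isCompact_Yset δ hA hT hne
  have hYn := Yset_nonempty δ hA hne hout
  have hYeq := Yset_eq_iUnion δ T hA
  refine ⟨fun q => ⟨hYn q, hYc q, Yset_subset_cube δ T hA q⟩, hYeq, fun X hX hXeq => ?_⟩
  have hXb := fun q => (hX q).2.isBounded
  have hYb := fun q => (hYc q).isBounded
  funext q
  exact Set.Subset.antisymm
    (subset_of_subinvariant_of_superinvariant δ hA hne hXb hYb hYn (fun q => (hYc q).isClosed)
      (fun q => (hXeq q).subset) (fun q => (hYeq q).superset) q)
    (subset_of_subinvariant_of_superinvariant δ hA hne hYb hXb (fun q => (hX q).1)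
      (fun q => (hX q).2.isClosed) (fun q => (hYeq q).subset) (fun q => (hXeq q).superset) q)
end

section
/- Let M be a d-tape automaton on alphabet A = A₁ × ⋯ × A_d, let q be a state of M, and let Y_q = {Δ(c) ∈ ℝ^d : c ∈ A^ℕ is q-accepted by M}. Then q admits a universal prefix if and only if Y_q has nonempty interior in ℝ^d. -/
/-- Prepend a finite word to an infinite sequence. -/
def prependSeq {α : Type*} (x : List α) (y : ℕ → α) : ℕ → α :=
  fun i => if h : i < x.length then x.get ⟨i, h⟩ else y (i - x.length)

/-! ### Positional expansions -/

namespace Real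

theorem mul_ofDigits {b : ℕ} (x : ℕ → Fin b) :
    (b : ℝ) * ofDigits x = (x 0 : ℕ) + ofDigits fun i => x (i + 1) := by
  have hb : (b : ℝ) ≠ 0 := by exact_mod_cast (Fin.pos (x 0)).ne'
  rw [ofDigits_eq_sum_add_ofDigits x 1]
  simp only [Finset.range_one, Finset.sum_singleton, ofDigitsTerm, zero_add, pow_one]
  field_simp

theorem ofDigits_pos {b : ℕ} {x : ℕ → Fin b} {i : ℕ} (hi : 0 < (x i : ℕ)) : 0 < ofDigits x := by
  have hb : (0 : ℝ) < b := by exact_mod_cast Fin.pos (x 0)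
  have h := mul_ofDigits x
  refine pos_of_mul_pos_right (a := (b : ℝ)) ?_ hb.le
  rw [h]
  induction i generalizing x with
  | zero =>
    have : (0 : ℝ) < (x 0 : ℕ) := by exact_mod_cast hi
    linarith [ofDigits_nonneg fun i => x (i + 1)]
  | succ i ih =>
    have h' := mul_ofDigits fun i => x (i + 1)
    have := ih (x := fun i => x (i + 1)) hi h'
    rw [← h'] at this
    have := pos_of_mul_pos_right this hb.le
    positivity

theorem ofDigits_lt_one {b : ℕ} {x : ℕ → Fin b} {i : ℕ} (hi : (x i : ℕ) + 1 < b) :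
    ofDigits x < 1 := by
  have hb : (0 : ℝ) < b := by exact_mod_cast Fin.pos (x 0)
  induction i generalizing x with
  | zero =>
    have h := mul_ofDigits x
    have : ((x 0 : ℕ) : ℝ) + 1 < b := by exact_mod_cast hi
    refine lt_of_mul_lt_mul_left (a := (b : ℝ)) ?_ hb.le
    linarith [ofDigits_le_one fun i => x (i + 1)]
  | succ i ih =>
    have h := mul_ofDigits x
    have := ih (x := fun i => x (i + 1)) hi
    have : ((x 0 : ℕ) : ℝ) + 1 ≤ b := by exact_mod_cast (x 0).isLt
    refine lt_of_mul_lt_mul_left (a := (b : ℝ)) ?_ hb.le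
    linarith

/-- An expansion with infinitely many nonzero and infinitely many non-maximal digits is the only
expansion of its value. -/
theorem eq_of_ofDigits_eq {b : ℕ} {x y : ℕ → Fin b} (h0 : ∀ n, ∃ i, 0 < (x (i + n) : ℕ))
    (h1 : ∀ n, ∃ i, (x (i + n) : ℕ) + 1 < b) (h : ofDigits x = ofDigits y) : x = y := by
  have head : ∀ n, ofDigits (fun i => x (i + n)) = ofDigits (fun i => y (i + n)) →
      x n = y n ∧ ofDigits (fun i => x (i + (n + 1))) = ofDigits (fun i => y (i + (n + 1))) := by
    intro n hn
    have hx := mul_ofDigits fun i => x (i + n)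
    have hy := mul_ofDigits fun i => y (i + n)
    simp only [zero_add, add_right_comm _ 1 n] at hx hy
    obtain ⟨i, hi⟩ := h0 (n + 1)
    obtain ⟨j, hj⟩ := h1 (n + 1)
    have hpos := ofDigits_pos (x := fun i => x (i + (n + 1))) hi
    have hlt := ofDigits_lt_one (x := fun i => x (i + (n + 1))) hj
    have hy0 := ofDigits_nonneg fun i => y (i + (n + 1))
    have hy1 := ofDigits_le_one fun i => y (i + (n + 1))
    simp only [← add_assoc] at hpos hlt hy0 hy1 ⊢
    have l1 : ((x n : ℕ) : ℝ) < (y n : ℕ) + 1 := by rw [hn] at hx; linarith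
    have l2 : ((y n : ℕ) : ℝ) < (x n : ℕ) + 1 := by rw [hn] at hx; linarith
    have e : (x n : ℕ) = y n := by
      have l1 : (x n : ℕ) < y n + 1 := by exact_mod_cast l1
      have l2 : (y n : ℕ) < x n + 1 := by exact_mod_cast l2
      omega
    refine ⟨Fin.ext e, ?_⟩
    rw [e] at hx
    rw [hn] at hx
    linarith
  have tail : ∀ n, ofDigits (fun i => x (i + n)) = ofDigits (fun i => y (i + n)) := by
    intro n
    induction n with
    | zero => exact h
    | succ n ih => exact (head n ih).2
  exact funext fun n => (head n (tail n)).1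

end Real

theorem deltaInf_eq_ofDigits {α : Type*} [Fintype α] (δ : α ≃ Fin (Fintype.card α)) (s : ℕ → α) :
    deltaInf δ s = Real.ofDigits fun i => δ (s i) := by
  simp only [deltaInf, Real.ofDigits, Real.ofDigitsTerm, div_eq_mul_inv]

theorem DeltaC_apply {d : ℕ} {A : Fin d → Type*} [∀ k, Fintype (A k)]
    (δ : (k : Fin d) → A k ≃ Fin (Fintype.card (A k))) (c : ℕ → (k : Fin d) → A k) (k : Fin d) :
    DeltaC δ c k = Real.ofDigits fun i => δ k (c i k) :=
  deltaInf_eq_ofDigits _ _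

theorem continuous_DeltaC {d : ℕ} {A : Fin d → Type*} [∀ k, Fintype (A k)]
    [TopologicalSpace ((k : Fin d) → A k)] [DiscreteTopology ((k : Fin d) → A k)]
    (δ : (k : Fin d) → A k ≃ Fin (Fintype.card (A k))) : Continuous (DeltaC δ) := by
  refine (PiLp.continuous_toLp 2 _).comp (continuous_pi fun k => ?_)
  simp only [deltaInf_eq_ofDigits]
  refine Real.continuous_ofDigits.comp (continuous_pi fun i => ?_)
  exact (continuous_of_discreteTopology (f := fun a : (k : Fin d) → A k => δ k (a k))).comp
    (continuous_apply i)

/-! ### Prefixes -/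

theorem prependSeq_of_lt {α : Type*} (x : List α) (y : ℕ → α) {i : ℕ} (h : i < x.length) :
    prependSeq x y i = x[i] := by
  simp [prependSeq, h]

theorem prependSeq_add_length {α : Type*} (x : List α) (y : ℕ → α) (i : ℕ) :
    prependSeq x y (i + x.length) = y i := by
  simp [prependSeq]

/-- The values of the configurations with prefix `x` contain an open box. -/
theorem interior_range_DeltaC_prependSeq_nonempty {d : ℕ} {A : Fin d → Type*}
    [∀ k, Fintype (A k)] (hA : ∀ k, 1 < Fintype.card (A k))
    (δ : (k : Fin d) → A k ≃ Fin (Fintype.card (A k))) (x : List ((k : Fin d) → A k)) :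
    (interior (Set.range fun y => DeltaC δ (prependSeq x y))).Nonempty := by
  let y₀ : ℕ → (k : Fin d) → A k := fun _ k => (δ k).symm ⟨0, by have := hA k; omega⟩
  set a : Fin d → ℝ := fun k => ∑ i ∈ Finset.range x.length,
    Real.ofDigitsTerm (fun i => δ k (prependSeq x y₀ i k)) i with ha
  set r : Fin d → ℝ := fun k => ((Fintype.card (A k) : ℝ) ^ x.length)⁻¹ with hr
  have hrpos : ∀ k, 0 < r k := fun k => by
    have : (0 : ℝ) < Fintype.card (A k) := by exact_mod_cast zero_lt_one.trans (hA k)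
    simp only [hr]
    positivity
  have hval : ∀ y k, DeltaC δ (prependSeq x y) k =
      a k + r k * Real.ofDigits fun i => δ k (y i k) := by
    intro y k
    rw [DeltaC_apply, Real.ofDigits_eq_sum_add_ofDigits _ x.length]
    simp only [prependSeq_add_length, ha, hr]
    congr 1
    refine Finset.sum_congr rfl fun i hi => ?_
    simp only [Real.ofDigitsTerm, prependSeq_of_lt _ _ (Finset.mem_range.mp hi)]
  refine ⟨WithLp.toLp 2 fun k => a k + r k / 2, mem_interior.mpr
    ⟨{p | ∀ k, p k ∈ Set.Ioo (a k) (a k + r k)}, ?_, ?_, ?_⟩⟩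
  · intro p hp
    have hdig : ∀ k, ∃ u : ℕ → Fin (Fintype.card (A k)), Real.ofDigits u = (p k - a k) / r k := by
      intro k
      obtain ⟨h1, h2⟩ := hp k
      obtain ⟨u, -, hu⟩ := Real.ofDigits_SurjOn (hA k) (a := (p k - a k) / r k)
        ⟨div_nonneg (by linarith) (hrpos k).le, (div_le_one (hrpos k)).mpr (by linarith)⟩
      exact ⟨u, hu⟩
    choose u hu using hdig
    refine ⟨fun i k => (δ k).symm (u k i), ?_⟩
    ext k
    simp only [hval, Equiv.apply_symm_apply]
    rw [hu, mul_div_cancel₀ _ (hrpos k).ne']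
    ring
  · simp only [Set.ofPred_forall]
    exact isOpen_iInter_of_finite fun k =>
      isOpen_Ioo.preimage (EuclideanSpace.proj (𝕜 := ℝ) k).continuous
  · intro k
    have := hrpos k
    constructor <;> simp only <;> linarith

/-! ### Accepted configurations -/

/-- The accepted configurations form a closed set: they are the projection of the closed set of
pairs (run, configuration) along the compact space of sequences of transitions. -/
theorem isClosed_setOf_acceptsD {d : ℕ} {Q : Type*} {A : Fin d → Type*}
    [TopologicalSpace ((k : Fin d) → A k)] [DiscreteTopology ((k : Fin d) → A k)]
    {T : Set (Q × Q × ((k : Fin d) → List (A k)))} (hT : T.Finite) (q : Q) :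
    IsClosed {c | AcceptsD T q c} := by
  have : Finite T := hT
  let _ : TopologicalSpace T := ⊥
  have : DiscreteTopology T := ⟨rfl⟩
  let S : Set ((ℕ → T) × (ℕ → (k : Fin d) → A k)) :=
    {p | (p.1 0).1.1 = q} ∩ (⋂ n, {p | (p.1 n).1.2.1 = (p.1 (n + 1)).1.1}) ∩
      ⋂ (k : Fin d) (n : ℕ) (m : ℕ) (j : ℕ),
        {p | (∑ i ∈ Finset.range n, ((p.1 i).1.2.2 k).length) = m →
          ∀ h : j < ((p.1 n).1.2.2 k).length, p.2 (m + j) k = ((p.1 n).1.2.2 k)[j]}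
  have hrun : ∀ n, Continuous fun p : (ℕ → T) × (ℕ → (k : Fin d) → A k) => p.1 n :=
    fun n => (continuous_apply n).comp continuous_fst
  have hS : IsClosed S := by
    refine IsClosed.inter (IsClosed.inter ?_ (isClosed_iInter fun n => ?_))
      (isClosed_iInter fun k => isClosed_iInter fun n => isClosed_iInter fun m =>
        isClosed_iInter fun j => ?_)
    · exact (isClosed_discrete {t : T | t.1.1 = q}).preimage (hrun 0)
    · exact (isClosed_discrete {t : T × T | t.1.1.2.1 = t.2.1.1}).preimage
        ((hrun n).prodMk (hrun (n + 1)))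
    · have hlen : Continuous fun p : (ℕ → T) × (ℕ → (k : Fin d) → A k) =>
          ∑ i ∈ Finset.range n, ((p.1 i).1.2.2 k).length :=
        continuous_finsetSum _ fun i _ =>
          (continuous_of_discreteTopology (f := fun t : T => (t.1.2.2 k).length)).comp (hrun i)
      have hval : Continuous fun p : (ℕ → T) × (ℕ → (k : Fin d) → A k) => p.2 (m + j) :=
        (continuous_apply _).comp continuous_snd
      exact (isClosed_discrete {z : T × ((k : Fin d) → A k) × ℕ | z.2.2 = m →
        ∀ h : j < (z.1.1.2.2 k).length, z.2.1 k = (z.1.1.2.2 k)[j]}).preimage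
        ((hrun n).prodMk (hval.prodMk hlen))
  convert isClosedMap_snd_of_compactSpace S hS using 1
  ext c
  constructor
  · rintro ⟨t, ht, h0, hstep, hcat⟩
    refine ⟨(fun n => ⟨t n, ht n⟩, c), ⟨⟨h0, Set.mem_iInter.mpr hstep⟩, ?_⟩, rfl⟩
    simp only [Set.mem_iInter, Set.mem_ofPred_eq]
    rintro k n m j rfl h
    exact hcat k n ⟨j, h⟩
  · rintro ⟨⟨t, c⟩, ⟨⟨h0, hstep⟩, hcat⟩, rfl⟩
    simp only [Set.mem_iInter, Set.mem_ofPred_eq] at hstep hcat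
    exact ⟨fun n => (t n).1, fun n => (t n).2, h0, hstep,
      fun k n j => hcat k n _ j rfl j.isLt⟩

/-- State `q` admits a universal prefix (a finite word `x` such that every
configuration beginning with `x` is `q`-accepted) if and only if `Y_q` has
nonempty interior in `ℝ^d`. -/
theorem universalPrefix_iff_Yset_nonempty_interior {d : ℕ} {Q : Type*} {A : Fin d → Type*}
    [∀ k, Fintype (A k)] (hA : ∀ k, 1 < Fintype.card (A k))
    (δ : (k : Fin d) → A k ≃ Fin (Fintype.card (A k)))
    (T : Set (Q × Q × ((k : Fin d) → List (A k)))) (hT : T.Finite)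
    (hne : ∀ t ∈ T, ∀ k : Fin d, t.2.2 k ≠ []) (q : Q) :
    (∃ x : List ((k : Fin d) → A k),
        ∀ y : ℕ → (k : Fin d) → A k, AcceptsD T q (prependSeq x y)) ↔
      (interior (Yset δ T q)).Nonempty := by
  constructor
  · rintro ⟨x, hx⟩
    refine (interior_range_DeltaC_prependSeq_nonempty hA δ x).mono (interior_mono ?_)
    rintro _ ⟨y, rfl⟩
    exact ⟨_, hx y, rfl⟩
  · rintro ⟨p, hp⟩
    obtain ⟨c₀, -, rfl⟩ := interior_subset hp
    let _ : TopologicalSpace ((k : Fin d) → A k) := ⊥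
    have : DiscreteTopology ((k : Fin d) → A k) := ⟨rfl⟩
    obtain ⟨_, ⟨c₁, N, rfl⟩, hc₀, hN⟩ :=
      (PiNat.isTopologicalBasis_cylinders fun _ => (k : Fin d) → A k).exists_subset_of_mem_open
        (show c₀ ∈ DeltaC δ ⁻¹' interior (Yset δ T q) from hp)
        (isOpen_interior.preimage (continuous_DeltaC δ))
    refine ⟨List.ofFn fun i : Fin N => c₁ i, fun y => ?_⟩
    set c := prependSeq (List.ofFn fun i : Fin N => c₁ i) y with hc
    have hcN : c ∈ PiNat.cylinder c₁ N := fun i hi => by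
      rw [hc, prependSeq_of_lt _ _ (by simpa using hi)]
      simp
    -- Configurations with a unique expansion are dense, so it suffices to accept those.
    refine (isClosed_setOf_acceptsD hT q).closure_subset
      ((PiNat.isTopologicalBasis_cylinders _).mem_closure_iff.mpr ?_)
    rintro _ ⟨c₂, L, rfl⟩ hcL
    let c' : ℕ → (k : Fin d) → A k := fun i => if i < N + L then c i else
      fun k => (δ k).symm ⟨i % 2, (Nat.mod_lt i two_pos).trans_le (hA k)⟩
    have hlow : ∀ i < N + L, c' i = c i := fun i hi => if_pos hi
    have hhigh : ∀ i k, N + L ≤ i → (δ k (c' i k) : ℕ) = i % 2 := fun i k hi => by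
      simp [c', not_lt.mpr hi]
    refine ⟨c', fun i hi => (hlow i (by omega)).trans (hcL i hi), ?_⟩
    have hc'N : c' ∈ PiNat.cylinder c₁ N :=
      fun i hi => (hlow i (by omega)).trans (hcN i hi)
    obtain ⟨c'', hacc, heq⟩ := interior_subset (hN hc'N)
    suffices c' = c'' from this ▸ hacc
    funext i k
    refine (δ k).injective (congrFun (Real.eq_of_ofDigits_eq (x := fun i => δ k (c' i k))
      (y := fun i => δ k (c'' i k)) (fun n => ?_) (fun n => ?_) ?_) i)
    · refine ⟨2 * (N + L) + n + 1, ?_⟩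
      rw [hhigh _ _ (by omega)]
      omega
    · refine ⟨2 * (N + L) + n, ?_⟩
      rw [hhigh _ _ (by omega)]
      have := hA k
      omega
    · rw [← DeltaC_apply, ← DeltaC_apply, heq]
end

section
/- There is no algorithm (no total computable function, for any fixed effective encoding of instances by natural numbers) that, given a d-dimensional affine graph-directed iterated function system whose maps are contracting affine maps with rational coefficients and in which every vertex has at least one outgoing edge, together with two distinguished vertices q and r, decides whether the intersection X_q ∩ X_r of the corresponding attractor components has empty interior in ℝ^d. -/
/-- An edge of a `d`-dimensional affine GIFS with rational coefficients and vertices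
encoded as natural numbers: (source, target, matrix as list of rows, translation vector). -/
abbrev GifsEdgeD : Type := ℕ × ℕ × List (List ℚ) × List ℚ

/-- The affine map `x ↦ M x + v` on `ℝ^d` determined by a rational matrix (given as a
list of rows) and a rational vector (given as a list). -/
noncomputable def gifsEdgeMapD (d : ℕ) (M : List (List ℚ)) (v : List ℚ) :
    EuclideanSpace ℝ (Fin d) → EuclideanSpace ℝ (Fin d) :=
  fun x => (WithLp.equiv 2 (Fin d → ℝ)).symm fun i =>
    (∑ j : Fin d, (((M.getD (i : ℕ) []).getD (j : ℕ) 0 : ℚ) : ℝ) * x j) +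
      ((v.getD (i : ℕ) 0 : ℚ) : ℝ)

/-- A map on `ℝ^d` is contracting: Lipschitz with some constant `c < 1`. -/
def IsContractingMapD (d : ℕ)
    (f : EuclideanSpace ℝ (Fin d) → EuclideanSpace ℝ (Fin d)) : Prop :=
  ∃ c : NNReal, c < 1 ∧ LipschitzWith c f

/-- Well-formed instance with dimension `d`, `m` vertices `0,…,m-1`, edge list `L` and
distinguished vertices `q`, `r`: all data have the right dimensions, every edge map is
contracting, every vertex has at least one outgoing edge. -/
def GifsWFD (d m : ℕ) (L : List GifsEdgeD) (q r : ℕ) : Prop :=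
  q < m ∧ r < m ∧
  (∀ e ∈ L, e.1 < m ∧ e.2.1 < m ∧
    e.2.2.1.length = d ∧ (∀ row ∈ e.2.2.1, row.length = d) ∧ e.2.2.2.length = d ∧
    IsContractingMapD d (gifsEdgeMapD d e.2.2.1 e.2.2.2)) ∧
  (∀ p < m, ∃ e ∈ L, e.1 = p)

/-- `X` is the family of attractors of the GIFS: nonempty compact sets indexed by the
vertices `p < m` satisfying the graph-directed fixed-point equations. -/
def IsGifsAttractorD (d m : ℕ) (L : List GifsEdgeD)
    (X : ℕ → Set (EuclideanSpace ℝ (Fin d))) : Prop :=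
  (∀ p < m, (X p).Nonempty ∧ IsCompact (X p)) ∧
  (∀ p < m, X p = ⋃ e ∈ L, ⋃ (_ : e.1 = p), gifsEdgeMapD d e.2.2.1 e.2.2.2 '' X e.2.1)

/-- Nondeterministic programs over natural number registers. -/
inductive CounterProg : Type
  | skip : CounterProg
  | inc : ℕ → CounterProg
  | dec : ℕ → CounterProg
  | zero : ℕ → CounterProg
  | seq : CounterProg → CounterProg → CounterProg
  | star : CounterProg → CounterProg

namespace CounterProg

open Function Relation

/-- The set of states in which a program started in the state `s` can terminate. -/
def run : CounterProg → (ℕ → ℕ) → Set (ℕ → ℕ)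
  | skip, s => {s}
  | inc i, s => {update s i (s i + 1)}
  | dec i, s => {s' | s i ≠ 0 ∧ s' = update s i (s i - 1)}
  | zero i, s => {s' | s i = 0 ∧ s' = s}
  | seq P Q, s => {s' | ∃ u ∈ P.run s, s' ∈ Q.run u}
  | star P, s => {s' | ReflTransGen (fun a b => b ∈ P.run a) s s'}

theorem run_seq_of_eq_singleton {P : CounterProg} {s u : ℕ → ℕ} (h : P.run s = {u})
    (Q : CounterProg) : (seq P Q).run s = Q.run u := by
  ext; simp [run, h]

/-- Repeat `P` as many times as the value of the register `i`, emptying that register. -/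
def loop (i : ℕ) (P : CounterProg) : CounterProg := seq (star (seq (dec i) P)) (zero i)

theorem mem_run_loop {i : ℕ} {P : CounterProg} {s s' : ℕ → ℕ} :
    s' ∈ (loop i P).run s ↔ (s i = 0 ∧ s' = s) ∨
      (s i ≠ 0 ∧ ∃ u ∈ P.run (update s i (s i - 1)), s' ∈ (loop i P).run u) := by
  constructor
  · rintro ⟨u, hu, h0, rfl⟩
    rcases ReflTransGen.cases_head hu with rfl | ⟨v, ⟨w, ⟨hw, rfl⟩, hv⟩, hvu⟩
    · exact .inl ⟨h0, rfl⟩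
    · exact .inr ⟨hw, v, hv, s', hvu, h0, rfl⟩
  · rintro (⟨h0, rfl⟩ | ⟨h0, u, hu, v, hv, h0', rfl⟩)
    · exact ⟨s', .refl, h0, rfl⟩
    · exact ⟨s', .head ⟨_, ⟨h0, rfl⟩, hu⟩ hv, h0', rfl⟩

theorem run_loop_eq {i : ℕ} {P : CounterProg} (n : ℕ) (σ : ℕ → ℕ → ℕ)
    (hi : ∀ j ≤ n, σ j i = n - j)
    (h : ∀ j < n, P.run (update (σ j) i (n - (j + 1))) = {σ (j + 1)}) :
    (loop i P).run (σ 0) = {σ n} := by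
  have key : ∀ k ≤ n, (loop i P).run (σ (n - k)) = {σ n} := by
    intro k
    induction k with
    | zero =>
      intro _
      ext s'
      rw [mem_run_loop]
      simp [hi n le_rfl]
    | succ k ih =>
      intro hk
      ext s'
      have e : n - (k + 1) + 1 = n - k := by omega
      have hn : σ (n - (k + 1)) i ≠ 0 := by rw [hi _ (by omega)]; omega
      have h1 := h (n - (k + 1)) (by omega)
      rw [e] at h1
      have h2 : σ (n - (k + 1)) i - 1 = n - (n - k) := by rw [hi _ (by omega)]; omega
      rw [mem_run_loop]
      simp only [hn, false_and, false_or, ne_eq, not_false_eq_true, true_and, h2, h1,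
        Set.mem_singleton_iff, exists_eq_left, ih (by omega)]
  simpa using key n le_rfl

/-- Set the register `i` to zero. -/
def clear (i : ℕ) : CounterProg := loop i skip

theorem run_clear (i : ℕ) (s : ℕ → ℕ) : (clear i).run s = {update s i 0} := by
  have := run_loop_eq (i := i) (P := skip) (s i) (fun j => update s i (s i - j)) (by simp)
    (by simp [run])
  simpa [clear] using this

/-- Add the register `i` to the register `j`, emptying the register `i`. -/
def move (i j : ℕ) : CounterProg := loop i (inc j)

theorem run_move {i j : ℕ} (hij : i ≠ j) (s : ℕ → ℕ) :
    (move i j).run s = {update (update s i 0) j (s j + s i)} := by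
  have := run_loop_eq (i := i) (P := inc j) (s i)
    (fun k => update (update s i (s i - k)) j (s j + k)) (by simp [hij])
    (fun k _ => by
      simp only [run, Set.singleton_eq_singleton_iff]
      ext x
      simp only [update_apply]
      grind)
  simpa [move] using this

/-- Add the register `i` to the register `j`, using the empty register `k`. -/
def copy (i j k : ℕ) : CounterProg := seq (loop i (seq (inc j) (inc k))) (move k i)

theorem run_copy {i j k : ℕ} (hij : i ≠ j) (hik : i ≠ k) (hjk : j ≠ k) (s : ℕ → ℕ)
    (hk : s k = 0) : (copy i j k).run s = {update s j (s j + s i)} := by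
  have := run_loop_eq (i := i) (P := seq (inc j) (inc k)) (s i)
    (fun l => update (update (update s i (s i - l)) j (s j + l)) k l) (by simp [hij, hik])
    (fun l _ => by
      simp only [run, Set.mem_singleton_iff, exists_eq_left, Set.ofPred_eq_eq_singleton,
        Set.singleton_eq_singleton_iff]
      ext x
      simp only [update_apply]
      grind)
  have h0 : update (update (update s i (s i - 0)) j (s j + 0)) k 0 = s := by
    ext x; simp only [update_apply]; grind
  rw [h0] at this
  rw [copy, run_seq_of_eq_singleton this, run_move hik.symm]
  congr 1
  ext x
  simp only [update_apply]
  grind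

/-- Set the `n` registers from `b` on to zero. -/
def clearRange (b : ℕ) : ℕ → CounterProg
  | 0 => skip
  | n + 1 => seq (clearRange b n) (clear (b + n))

theorem run_clearRange (b n : ℕ) (s : ℕ → ℕ) :
    (clearRange b n).run s = {fun x => if b ≤ x ∧ x < b + n then 0 else s x} := by
  induction n with
  | zero =>
    have : ∀ x, ¬ (b ≤ x ∧ x < b) := by omega
    simp [clearRange, run, this]
  | succ n ih =>
    rw [clearRange, run_seq_of_eq_singleton ih, run_clear]
    congr 1
    ext x
    simp only [update_apply]
    grind

/-- A partial function is computable by counter programs that read the arguments from given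
registers, add the result to a given empty register, and use the registers from `b` on, which
are empty before and after, as scratch space. -/
def Computes {n : ℕ} (f : List.Vector ℕ n →. ℕ) : Prop :=
  ∀ (inp : Fin n → ℕ) (out b : ℕ), (∀ k, inp k < b) → out < b → (∀ k, inp k ≠ out) →
    ∃ P : CounterProg, ∀ s : ℕ → ℕ, (∀ j ≥ b, s j = 0) → s out = 0 →
      P.run s = {s' | ∃ y ∈ f (.ofFn fun k => s (inp k)), s' = update s out y}

theorem Computes.of_total {n : ℕ} {f : List.Vector ℕ n → ℕ}
    (h : ∀ (inp : Fin n → ℕ) (out b : ℕ), (∀ k, inp k < b) → out < b → (∀ k, inp k ≠ out) →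
      ∃ P : CounterProg, ∀ s : ℕ → ℕ, (∀ j ≥ b, s j = 0) → s out = 0 →
        P.run s = {update s out (f (.ofFn fun k => s (inp k)))}) :
    Computes (f : List.Vector ℕ n →. ℕ) := by
  intro inp out b h1 h2 h3
  obtain ⟨P, hP⟩ := h inp out b h1 h2 h3
  exact ⟨P, fun s hs h0 => by rw [hP s hs h0]; ext; simp⟩

theorem Computes.total {n : ℕ} {f : List.Vector ℕ n → ℕ}
    (h : Computes (f : List.Vector ℕ n →. ℕ)) (inp : Fin n → ℕ) (out b : ℕ)
    (h1 : ∀ k, inp k < b) (h2 : out < b) (h3 : ∀ k, inp k ≠ out) :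
    ∃ P : CounterProg, ∀ s : ℕ → ℕ, (∀ j ≥ b, s j = 0) → s out = 0 →
      P.run s = {update s out (f (.ofFn fun k => s (inp k)))} := by
  obtain ⟨P, hP⟩ := h inp out b h1 h2 h3
  exact ⟨P, fun s hs h0 => by rw [hP s hs h0]; ext; simp⟩

theorem mem_mOfFn {n : ℕ} (g : Fin n → Part ℕ) (v : List.Vector ℕ n) :
    v ∈ List.Vector.mOfFn g ↔ ∀ i, v.get i ∈ g i := by
  induction n with
  | zero => simp [List.Vector.mOfFn, pure, List.Vector.eq_nil v]
  | succ n ih =>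
    rw [Fin.forall_fin_succ]
    simp only [List.Vector.mOfFn, Part.bind_eq_bind, Part.mem_bind_iff, ih, Part.pure_eq_some,
      Part.mem_some_iff]
    constructor
    · rintro ⟨a, ha, w, hw, rfl⟩
      exact ⟨by simpa using ha, by simpa using hw⟩
    · rintro ⟨h0, h1⟩
      exact ⟨_, h0, v.tail, by simpa using h1, by simp⟩

theorem computes_zero : Computes ((fun _ => 0 : List.Vector ℕ 0 → ℕ) : List.Vector ℕ 0 →. ℕ) :=
  .of_total fun _ _ _ _ _ _ => ⟨skip, fun s _ h0 => by simp [run, ← h0]⟩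

theorem computes_get {n : ℕ} (i : Fin n) :
    Computes ((fun v => v.get i : List.Vector ℕ n → ℕ) : List.Vector ℕ n →. ℕ) :=
  .of_total fun inp out b h1 h2 h3 => ⟨copy (inp i) out b, fun s hs h0 => by
    rw [run_copy (h3 i) (h1 i).ne h2.ne _ (hs b le_rfl)]; simp [h0]⟩

theorem computes_succ :
    Computes ((fun v => v.head.succ : List.Vector ℕ 1 → ℕ) : List.Vector ℕ 1 →. ℕ) :=
  .of_total fun inp out b h1 h2 h3 => ⟨seq (copy (inp 0) out b) (inc out), fun s hs h0 => by
    rw [run_seq_of_eq_singleton (run_copy (h3 0) (h1 0).ne h2.ne _ (hs b le_rfl))]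
    simp [h0, run, List.Vector.ofFn]⟩

theorem Computes.comp {m n : ℕ} {f : List.Vector ℕ n →. ℕ} {g : Fin n → List.Vector ℕ m →. ℕ}
    (hf : Computes f) (hg : ∀ i, Computes (g i)) :
    Computes fun v => (List.Vector.mOfFn fun i => g i v) >>= f := by
  intro inp out b h1 h2 h3
  have args : ∀ k ≤ n, ∃ P : CounterProg, ∀ s : ℕ → ℕ, (∀ j ≥ b, s j = 0) →
      P.run s = {s' | ∃ y : ℕ → ℕ,
        (∀ i : Fin n, i < k → y i ∈ g i (.ofFn fun l => s (inp l))) ∧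
        s' = fun x => if b ≤ x ∧ x < b + k then y (x - b) else s x} := by
    intro k
    induction k with
    | zero =>
      refine fun _ => ⟨skip, fun s _ => ?_⟩
      have : ∀ x, ¬ (b ≤ x ∧ x < b) := by omega
      ext; simp [run, this]
    | succ k ih =>
      intro hk
      obtain ⟨P, hP⟩ := ih (by omega)
      obtain ⟨Q, hQ⟩ := hg ⟨k, hk⟩ inp (b + k) (b + n) (fun l => by have := h1 l; omega)
        (by omega) (fun l => by have := h1 l; omega)
      refine ⟨seq P Q, fun s hs => ?_⟩
      ext s'
      simp only [run, hP s hs, Set.mem_ofPred_eq]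
      have inputs : ∀ y : ℕ → ℕ, (fun l => (fun x => if b ≤ x ∧ x < b + k then y (x - b) else s x)
          (inp l)) = fun l => s (inp l) := by
        intro y; ext l; have := h1 l; grind
      constructor
      · rintro ⟨_, ⟨y, hy, rfl⟩, hs'⟩
        rw [hQ _ (fun j hj => by have := hs j (by omega); grind)
          (by have := hs (b + k) (by omega); simp [this])] at hs'
        obtain ⟨z, hz, rfl⟩ := hs'
        rw [inputs y] at hz
        refine ⟨update y k z, fun i hi => ?_, ?_⟩
        · by_cases hik : (i : ℕ) = k
          · obtain rfl : i = ⟨k, hk⟩ := Fin.ext hik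
            simpa using hz
          · rw [update_of_ne hik]
            exact hy i (by omega)
        · ext x
          simp only [update_apply]
          grind
      · rintro ⟨y, hy, rfl⟩
        refine ⟨_, ⟨y, fun i hi => hy i (by omega), rfl⟩, ?_⟩
        rw [hQ _ (fun j hj => by have := hs j (by omega); grind)
          (by have := hs (b + k) (by omega); simp [this]), inputs y]
        refine ⟨y k, hy ⟨k, hk⟩ (by simp), ?_⟩
        ext x
        simp only [update_apply]
        grind
  obtain ⟨P, hP⟩ := args n le_rfl
  obtain ⟨Q, hQ⟩ := hf (fun i => b + i) out (b + n) (by simp) (by omega) (fun k => by omega)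
  refine ⟨seq P (seq Q (clearRange b n)), fun s hs h0 => ?_⟩
  ext s'
  have hbind : ∀ (w : List.Vector ℕ m) (z : ℕ),
      z ∈ ((List.Vector.mOfFn fun i => g i w) >>= f : Part ℕ) ↔
        ∃ v, (∀ i, v.get i ∈ g i w) ∧ z ∈ f v := by
    exact fun w z => Part.mem_bind_iff.trans
      (exists_congr fun v => and_congr_left' (mem_mOfFn (fun i => g i w) v))
  refine Iff.trans ?_ (exists_congr fun z => and_congr_left' (hbind _ z)).symm
  simp only [run, hP s hs, Set.mem_ofPred_eq, run_clearRange]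
  have hQ' : ∀ y : ℕ → ℕ, Q.run (fun x => if b ≤ x ∧ x < b + n then y (x - b) else s x) =
      {s' | ∃ z ∈ f (.ofFn fun i => y i),
        s' = update (fun x => if b ≤ x ∧ x < b + n then y (x - b) else s x) out z} := by
    intro y
    rw [hQ _ (fun j hj => by have := hs j (by omega); grind) (by grind)]
    simp
  have final : ∀ (y : ℕ → ℕ) (z : ℕ), (fun x => if b ≤ x ∧ x < b + n then 0 else
      update (fun x => if b ≤ x ∧ x < b + n then y (x - b) else s x) out z x) =
      update s out z := by
    intro y z
    ext x
    have := hs x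
    simp only [update_apply]
    grind
  constructor
  · rintro ⟨_, ⟨y, hy, rfl⟩, u, hu, hs'⟩
    rw [hQ' y] at hu
    obtain ⟨z, hz, rfl⟩ := hu
    refine ⟨z, ⟨.ofFn fun i => y i, fun i => by simpa using hy i i.2, hz⟩, ?_⟩
    rw [Set.mem_singleton_iff.1 hs', final]
  · rintro ⟨z, ⟨v, hv, hz⟩, rfl⟩
    obtain ⟨y, hy⟩ : ∃ y : ℕ → ℕ, ∀ i : Fin n, y i = v.get i :=
      ⟨fun x => if h : x < n then v.get ⟨x, h⟩ else 0, by simp⟩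
    refine ⟨_, ⟨y, fun i _ => by simpa [hy] using hv i, rfl⟩, _, ?_,
      Set.mem_singleton_iff.2 (final y z).symm⟩
    rw [hQ' y]
    exact ⟨z, by simpa [hy] using hz, rfl⟩

theorem Computes.prec {n : ℕ} {f : List.Vector ℕ n → ℕ} {g : List.Vector ℕ (n + 2) → ℕ}
    (hf : Computes (f : List.Vector ℕ n →. ℕ)) (hg : Computes (g : List.Vector ℕ (n + 2) →. ℕ)) :
    Computes ((fun v => Nat.rec (f v.tail) (fun y IH => g (y ::ᵥ IH ::ᵥ v.tail)) v.head :
      List.Vector ℕ (n + 1) → ℕ) : List.Vector ℕ (n + 1) →. ℕ) := by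
  refine .of_total fun inp out b h1 h2 h3 => ?_
  have hb : ∀ k, inp k ≠ b ∧ inp k ≠ b + 1 ∧ inp k ≠ b + 2 ∧ inp k ≠ b + 3 :=
    fun k => by have := h1 k; omega
  obtain ⟨F, hF⟩ := hf.total (fun k => inp k.succ) (b + 2) (b + 4)
    (fun k => by have := h1 k.succ; omega) (by omega) (fun k => (hb _).2.2.1)
  obtain ⟨G, hG⟩ := hg.total (Fin.cons (b + 1) (Fin.cons (b + 2) fun k => inp k.succ)) (b + 3)
    (b + 4) (by
      simp only [Fin.forall_fin_succ, Fin.cons_zero, Fin.cons_succ]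
      exact ⟨by omega, by omega, fun k => by have := h1 k.succ; omega⟩) (by omega) (by
      simp only [Fin.forall_fin_succ, Fin.cons_zero, Fin.cons_succ]
      exact ⟨by omega, by omega, fun k => (hb _).2.2.2⟩)
  refine ⟨seq (copy (inp 0) b (b + 4)) (seq F (seq
    (loop b (seq G (seq (clear (b + 2)) (seq (move (b + 3) (b + 2)) (inc (b + 1))))))
    (seq (move (b + 2) out) (clear (b + 1))))), fun s hs h0 => ?_⟩
  set v : List.Vector ℕ n := .ofFn fun k => s (inp k.succ) with hv
  set r : ℕ → ℕ := fun l => Nat.rec (f v) (fun y IH => g (y ::ᵥ IH ::ᵥ v)) l with hr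
  set σ : ℕ → ℕ → ℕ := fun l =>
    update (update (update s b (s (inp 0) - l)) (b + 1) l) (b + 2) (r l) with hσ
  have hsb : ∀ i, s (b + i) = 0 := fun i => hs _ (by omega)
  have hsb0 : s b = 0 := hs _ le_rfl
  have step : ∀ l < s (inp 0), (seq G (seq (clear (b + 2)) (seq (move (b + 3) (b + 2))
      (inc (b + 1))))).run (update (σ l) b (s (inp 0) - (l + 1))) = {σ (l + 1)} := by
    intro l _
    have hG' := hG (update (σ l) b (s (inp 0) - (l + 1)))
      (fun j hj => by simp only [hσ, update_apply]; have := hs j; grind)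
      (by simp only [hσ, update_apply]; have := hsb 3; grind)
    rw [run_seq_of_eq_singleton hG', run_seq_of_eq_singleton (run_clear _ _),
      run_seq_of_eq_singleton (run_move (by omega) _)]
    have harg : (List.Vector.ofFn fun k => update (σ l) b (s (inp 0) - (l + 1))
        ((Fin.cons (b + 1) (Fin.cons (b + 2) fun k => inp k.succ) : Fin (n + 2) → ℕ) k)) =
        l ::ᵥ r l ::ᵥ v := by
      simp only [List.Vector.ofFn, Fin.cons_zero, Fin.cons_succ]
      congr 1
      · simp [hσ]
      · congr 1
        · simp [hσ]
        · rw [hv]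
          congr 1
          ext k
          have := hb k.succ
          simp [hσ, this]
    rw [harg]
    simp only [run, Set.singleton_eq_singleton_iff]
    ext x
    have hr1 : r (l + 1) = g (l ::ᵥ r l ::ᵥ v) := rfl
    have := hsb 3
    simp only [hσ, update_apply, ← hr1]
    grind
  have hloop := run_loop_eq (s (inp 0)) σ (fun j _ => by simp [hσ]) step
  rw [run_seq_of_eq_singleton (run_copy (hb 0).1 (by have := h1 0; omega) (by omega) _ (hsb 4))]
  have hF' := hF (update s b (s b + s (inp 0)))
      (fun j hj => by simp only [update_apply]; have := hs j; grind)
      (by simp only [update_apply]; have := hsb 2; grind)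
  have harg : (List.Vector.ofFn fun k : Fin n => update s b (s b + s (inp 0)) (inp k.succ)) =
      v := by
    rw [hv]
    congr 1
    ext k
    simp [(hb k.succ).1]
  have hσ0 : update (update s b (s b + s (inp 0))) (b + 2) (f v) = σ 0 := by
    ext x
    have hr0 : r 0 = f v := rfl
    have := hsb 1
    simp only [hσ, update_apply, ← hr0]
    grind
  rw [harg, hσ0] at hF'
  rw [run_seq_of_eq_singleton hF', run_seq_of_eq_singleton hloop,
    run_seq_of_eq_singleton (run_move (by omega) _), run_clear]
  have hres : (Nat.rec (f (List.Vector.ofFn fun k => s (inp k)).tail)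
      (fun y IH => g (y ::ᵥ IH ::ᵥ (List.Vector.ofFn fun k => s (inp k)).tail))
      (List.Vector.ofFn fun k => s (inp k)).head : ℕ) = r (s (inp 0)) := by
    simp only [List.Vector.ofFn, List.Vector.tail_cons, List.Vector.head_cons]
    rfl
  rw [hres, Set.singleton_eq_singleton_iff]
  ext x
  have := hsb 1
  have := hsb 2
  simp only [hσ, update_apply]
  grind

theorem Computes.rfind {n : ℕ} {f : List.Vector ℕ (n + 1) → ℕ}
    (hf : Computes (f : List.Vector ℕ (n + 1) →. ℕ)) :
    Computes fun v => Nat.rfind fun m => Part.some (decide (f (m ::ᵥ v) = 0)) := by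
  intro inp out b h1 h2 h3
  have hb : ∀ k, inp k ≠ b ∧ inp k ≠ b + 1 := fun k => by have := h1 k; omega
  obtain ⟨F, hF⟩ := hf.total (Fin.cons b inp) (b + 1) (b + 2) (by
      simp only [Fin.forall_fin_succ, Fin.cons_zero, Fin.cons_succ]
      exact ⟨by omega, fun k => by have := h1 k; omega⟩) (by omega) (by
      simp only [Fin.forall_fin_succ, Fin.cons_zero, Fin.cons_succ]
      exact ⟨by omega, fun k => (hb _).2⟩)
  set B : CounterProg := seq F (seq (dec (b + 1)) (seq (clear (b + 1)) (inc b))) with hB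
  refine ⟨seq (star B) (seq F (seq (zero (b + 1)) (move b out))), fun s hs h0 => ?_⟩
  set v : List.Vector ℕ n := .ofFn fun k => s (inp k) with hv
  have hsb : s (b + 1) = 0 := hs _ (by omega)
  have hsb0 : s b = 0 := hs _ le_rfl
  have hF' : ∀ l, F.run (update s b l) = {update (update s b l) (b + 1) (f (l ::ᵥ v))} := by
    intro l
    rw [hF _ (fun j hj => by simp only [update_apply]; have := hs j; grind)
      (by simp only [update_apply]; grind)]
    congr 3
    simp only [List.Vector.ofFn, Fin.cons_zero, Fin.cons_succ]
    congr 1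
    · simp
    · rw [hv]
      congr 2
      ext k
      simp [hb k]
  have hBrun : ∀ l, B.run (update s b l) =
      {s' | f (l ::ᵥ v) ≠ 0 ∧ s' = update s b (l + 1)} := by
    intro l
    rw [hB, run_seq_of_eq_singleton (hF' l)]
    have hst : ∀ y z, update (update (update (update (update s b l) (b + 1) y) (b + 1) z)
        (b + 1) 0) b (l + 1) = update s b (l + 1) := by
      intro y z
      ext x
      simp only [update_apply]
      grind
    ext s'
    simp only [run, run_clear, Set.mem_ofPred_eq, Set.mem_singleton_iff]
    constructor
    · rintro ⟨_, ⟨h, rfl⟩, _, rfl, rfl⟩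
      refine ⟨by simpa using h, ?_⟩
      rw [← hst (f (l ::ᵥ v)) (f (l ::ᵥ v) - 1)]
      simp
    · rintro ⟨h, rfl⟩
      refine ⟨_, ⟨by simpa using h, rfl⟩, _, rfl, ?_⟩
      rw [← hst (f (l ::ᵥ v)) (f (l ::ᵥ v) - 1)]
      simp
  have hstar : ∀ s', s' ∈ (star B).run s ↔ ∃ l, (∀ j < l, f (j ::ᵥ v) ≠ 0) ∧
      s' = update s b l := by
    intro s'
    have hs0 : s = update s b 0 := by rw [← hsb0]; simp
    constructor
    · intro h
      induction h with
      | refl => exact ⟨0, by simp, hs0⟩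
      | tail _ h ih =>
        obtain ⟨l, hl, rfl⟩ := ih
        rw [hBrun] at h
        refine ⟨l + 1, fun j hj => ?_, h.2⟩
        rcases Nat.lt_succ_iff_lt_or_eq.1 hj with hj | rfl
        exacts [hl j hj, h.1]
    · rintro ⟨l, hl, rfl⟩
      induction l with
      | zero => rw [← hs0]; exact .refl
      | succ l ih =>
        refine .tail (ih fun j hj => hl j (by omega)) ?_
        rw [hBrun]
        exact ⟨hl l (by omega), rfl⟩
  have hend : ∀ l, (seq F (seq (zero (b + 1)) (move b out))).run (update s b l) =
      {s' | f (l ::ᵥ v) = 0 ∧ s' = update s out l} := by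
    intro l
    rw [run_seq_of_eq_singleton (hF' l)]
    ext s'
    simp only [run, run_move (show b ≠ out by omega), Set.mem_ofPred_eq, Set.mem_singleton_iff,
      update_self]
    have hst : f (l ::ᵥ v) = 0 → update (update (update (update s b l) (b + 1) (f (l ::ᵥ v))) b 0)
        out (update (update s b l) (b + 1) (f (l ::ᵥ v)) out +
          update (update s b l) (b + 1) (f (l ::ᵥ v)) b) = update s out l := by
      intro h
      ext x
      simp only [update_apply, h]
      grind
    constructor
    · rintro ⟨_, ⟨h, rfl⟩, rfl⟩
      exact ⟨h, hst h⟩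
    · rintro ⟨h, rfl⟩
      exact ⟨_, ⟨h, rfl⟩, (hst h).symm⟩
  ext s'
  have hmem : s' ∈ (seq (star B) (seq F (seq (zero (b + 1)) (move b out)))).run s ↔
      ∃ u ∈ (star B).run s, s' ∈ (seq F (seq (zero (b + 1)) (move b out))).run u := Iff.rfl
  rw [hmem]
  have hfind : ∀ y, y ∈ (Nat.rfind fun m => Part.some (decide (f (m ::ᵥ v) = 0))) ↔
      f (y ::ᵥ v) = 0 ∧ ∀ j < y, f (j ::ᵥ v) ≠ 0 := fun y => by
    refine Nat.mem_rfind.trans ?_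
    simp
  refine Iff.trans ?_ (exists_congr fun y => and_congr_left' (hfind y)).symm
  simp only [hstar]
  constructor
  · rintro ⟨_, ⟨l, hl, rfl⟩, h⟩
    rw [hend] at h
    exact ⟨l, ⟨h.1, hl⟩, h.2⟩
  · rintro ⟨l, ⟨h, hl⟩, rfl⟩
    refine ⟨_, ⟨l, hl, rfl⟩, ?_⟩
    rw [hend]
    exact ⟨h, rfl⟩

theorem computes_of_primrec' {n : ℕ} {f : List.Vector ℕ n → ℕ} (hf : Nat.Primrec' f) :
    Computes (f : List.Vector ℕ n →. ℕ) := by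
  induction hf with
  | zero => exact computes_zero
  | succ => exact computes_succ
  | get i => exact computes_get i
  | comp g _ _ hf hg =>
    refine (congrArg Computes (funext fun v => ?_)).mp (hf.comp hg)
    change Part.bind (List.Vector.mOfFn fun i => Part.some (g i v)) _ = _
    rw [Vector.mOfFn_part_some]
    exact Part.bind_some _ _
  | prec _ _ hf hg => exact hf.prec hg

theorem computes_of_partrec' {n : ℕ} {f : List.Vector ℕ n →. ℕ} (hf : Nat.Partrec' f) :
    Computes f := by
  induction hf with
  | prim hf => exact computes_of_primrec' hf
  | comp g _ _ hf hg => exact hf.comp hg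
  | rfind _ hf => exact hf.rfind

/-- For each partial recursive function there is a program which, started with `x + 1` in the
register `0` and all other registers empty, can empty all registers if and only if the function
is defined at `x`. -/
theorem exists_run_eq_zero_iff_dom {f : ℕ →. ℕ} (hf : Partrec f) :
    ∃ P : CounterProg, ∀ x, 0 ∈ P.run (update (0 : ℕ → ℕ) 0 (x + 1)) ↔ (f x).Dom := by
  obtain ⟨P, hP⟩ := computes_of_partrec' (Nat.Partrec'.part_iff₁.2 hf) (fun _ => 0) 1 2
    (by simp) (by simp) (by simp)
  refine ⟨seq (dec 0) (seq P (seq (clear 0) (clear 1))), fun x => ?_⟩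
  have h1 : (dec 0).run (update (0 : ℕ → ℕ) 0 (x + 1)) = {update (0 : ℕ → ℕ) 0 x} := by
    ext; simp [run]
  rw [run_seq_of_eq_singleton h1]
  have h2 := hP (update (0 : ℕ → ℕ) 0 x) (fun j hj => by simp [update_apply]; omega) (by simp)
  simp only [run, h2, run_clear, Set.mem_ofPred_eq, Set.mem_singleton_iff, update_self,
    List.Vector.ofFn, List.Vector.head_cons, Part.dom_iff_mem]
  constructor
  · rintro ⟨_, ⟨y, hy, -⟩, -⟩
    exact ⟨y, hy⟩
  · rintro ⟨y, hy⟩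
    refine ⟨_, ⟨y, hy, rfl⟩, _, rfl, ?_⟩
    ext i
    simp only [update_apply, Pi.zero_apply]
    grind

end CounterProg

namespace Language

open Computability

variable {α : Type*} {L M : Language α}

theorem IsRegular.mul (hL : L.IsRegular) (hM : M.IsRegular) : (L * M).IsRegular := by
  refine .of_finite_range_leftQuotient (Set.Finite.subset
    (Set.Finite.image2 (fun (A : Language α) (S : Set (Language α)) => A * M + ⨆ B ∈ S, B)
      hL.finite_range_leftQuotient hM.finite_range_leftQuotient.finite_subsets) ?_)
  rintro _ ⟨x, rfl⟩
  refine ⟨L.leftQuotient x, ⟨x, rfl⟩,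
    {B | ∃ u v, u ++ v = x ∧ u ∈ L ∧ M.leftQuotient v = B}, ?_, ?_⟩
  · rintro _ ⟨u, v, -, -, rfl⟩
    exact ⟨v, rfl⟩
  · ext y
    simp only [mem_add, mem_iSup, mem_leftQuotient, mem_mul]
    constructor
    · rintro (⟨a, ha, b, hb, rfl⟩ | ⟨_, ⟨u, v, rfl, hu, rfl⟩, hy⟩)
      · exact ⟨x ++ a, ha, b, hb, by simp⟩
      · exact ⟨u, hu, v ++ y, hy, by simp⟩
    · rintro ⟨a, ha, b, hb, h⟩
      rcases List.append_eq_append_iff.1 h with ⟨c, rfl, rfl⟩ | ⟨c, rfl, rfl⟩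
      · exact .inr ⟨_, ⟨a, c, rfl, ha, rfl⟩, hb⟩
      · exact .inl ⟨c, ha, b, hb, rfl⟩

theorem append_mem_kstar_iff {x y : List α} : x ++ y ∈ L∗ ↔
    (x = [] ∧ y ∈ L∗) ∨ ∃ u v a b, u ++ v = x ∧ u ∈ L∗ ∧ v ++ a ∈ L ∧ b ∈ L∗ ∧ a ++ b = y := by
  constructor
  · rintro ⟨W, hxy, hW⟩
    induction W generalizing x with
    | nil =>
      obtain ⟨rfl, rfl⟩ := List.append_eq_nil_iff.1 (hxy.trans List.flatten_nil)
      exact .inl ⟨rfl, nil_mem_kstar L⟩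
    | cons w W ih =>
      have hw : w ∈ L := hW w (by simp)
      have hW' : W.flatten ∈ L∗ := join_mem_kstar fun z hz => hW z (by simp [hz])
      rw [List.flatten_cons] at hxy
      rcases List.append_eq_append_iff.1 hxy with ⟨c, rfl, rfl⟩ | ⟨c, rfl, h⟩
      · exact .inr ⟨[], x, c, _, rfl, nil_mem_kstar L, hw, hW', rfl⟩
      · rcases ih h.symm fun z hz => hW z (by simp [hz]) with
          ⟨rfl, hy⟩ | ⟨u, v, a, b, rfl, hu, hv, hb, rfl⟩
        · exact .inr ⟨[], w, [], y, by simp, nil_mem_kstar L, by simpa using hw, hy, rfl⟩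
        · refine .inr ⟨w ++ u, v, a, b, by simp, ?_, hv, hb, rfl⟩
          obtain ⟨Z, rfl, hZ⟩ := hu
          exact ⟨w :: Z, by simp, by simpa [hw] using hZ⟩
  · rintro (⟨rfl, hy⟩ | ⟨u, v, a, b, rfl, ⟨U, rfl, hU⟩, hv, ⟨B, rfl, hB⟩, rfl⟩)
    · exact hy
    · refine ⟨U ++ (v ++ a) :: B, by simp, fun z hz => ?_⟩
      rcases List.mem_append.1 hz with hz | hz
      · exact hU z hz
      · rcases List.mem_cons.1 hz with rfl | hz
        exacts [hv, hB z hz]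

theorem IsRegular.kstar (hL : L.IsRegular) : (L∗).IsRegular := by
  refine .of_finite_range_leftQuotient (Set.Finite.subset
    ((hL.finite_range_leftQuotient.finite_subsets.image
      fun S => ⨆ A ∈ S, A * L∗).insert L∗) ?_)
  rintro _ ⟨x, rfl⟩
  rcases eq_or_ne x [] with rfl | hx
  · exact .inl rfl
  refine .inr ⟨{A | ∃ u v, u ++ v = x ∧ u ∈ L∗ ∧ L.leftQuotient v = A}, ?_, ?_⟩
  · rintro _ ⟨u, v, -, -, rfl⟩
    exact ⟨v, rfl⟩
  · ext y
    simp only [mem_iSup, mem_leftQuotient, append_mem_kstar_iff, hx, false_and, false_or, mem_mul]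
    constructor
    · rintro ⟨_, ⟨u, v, rfl, hu, rfl⟩, a, ha, b, hb, rfl⟩
      exact ⟨u, v, a, b, rfl, hu, ha, hb, rfl⟩
    · rintro ⟨u, v, a, b, rfl, hu, hv, hb, rfl⟩
      exact ⟨_, ⟨u, v, rfl, hu, rfl⟩, a, hv, b, hb, rfl⟩

theorem IsRegular.of_finite (hL : (L : Set (List α)).Finite) : L.IsRegular := by
  refine .of_finite_range_leftQuotient (Set.Finite.subset
    ((hL.biUnion fun w _ => (w.tails.finite_toSet)).finite_subsets) ?_)
  rintro _ ⟨x, rfl⟩ y hy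
  exact Set.mem_biUnion hy (by simp)

end Language

/-- The bits that the word `w` contains on the tape `j`. -/
def tapeContent (j : ℕ) (w : List (ℕ × Bool)) : List Bool :=
  w.filterMap fun a => if a.1 = j then some a.2 else none

@[simp]
theorem tapeContent_nil (j : ℕ) : tapeContent j [] = [] := rfl

@[simp]
theorem tapeContent_cons (j : ℕ) (a : ℕ × Bool) (w : List (ℕ × Bool)) :
    tapeContent j (a :: w) = if a.1 = j then a.2 :: tapeContent j w else tapeContent j w := by
  by_cases h : a.1 = j <;> simp [tapeContent, h]

@[simp]
theorem tapeContent_append (j : ℕ) (u v : List (ℕ × Bool)) :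
    tapeContent j (u ++ v) = tapeContent j u ++ tapeContent j v := by
  simp [tapeContent]

theorem tapeContent_replicate (j n : ℕ) (a : ℕ × Bool) :
    tapeContent j (List.replicate n a) = if a.1 = j then List.replicate n a.2 else [] := by
  induction n with
  | zero => simp
  | succ n ih => simp [List.replicate_succ, ih]; grind

theorem tapeContent_eq_nil {j : ℕ} {w : List (ℕ × Bool)} (h : ∀ a ∈ w, a.1 ≠ j) :
    tapeContent j w = [] := by
  simp only [tapeContent, List.filterMap_eq_nil_iff]
  exact fun a ha => by simp [h a ha]

theorem sum_length_tapeContent {N : ℕ} {w : List (ℕ × Bool)} (h : ∀ a ∈ w, a.1 < N) :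
    ∑ j ∈ Finset.range N, (tapeContent j w).length = w.length := by
  induction w with
  | nil => simp
  | cons a w ih =>
    rw [List.forall_mem_cons] at h
    rw [List.length_cons, ← ih h.2]
    have : ∀ j, (tapeContent j (a :: w)).length =
        (tapeContent j w).length + if a.1 = j then 1 else 0 := by
      intro j; by_cases h : a.1 = j <;> simp [h]
    simp only [this, Finset.sum_add_distrib]
    simp [h.1]

theorem length_eq_of_tapeContent_eq {N : ℕ} {u v : List (ℕ × Bool)} (hu : ∀ a ∈ u, a.1 < N)
    (hv : ∀ a ∈ v, a.1 < N) (h : ∀ j, tapeContent j u = tapeContent j v) :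
    u.length = v.length := by
  rw [← sum_length_tapeContent hu, ← sum_length_tapeContent hv]
  simp [h]

/-- A self-delimiting unary code for natural numbers. -/
def unaryCode (a : ℕ) : List Bool := List.replicate a true ++ [false]

@[simp]
theorem unaryCode_zero : unaryCode 0 = [false] := rfl

theorem unaryCode_succ (a : ℕ) : unaryCode (a + 1) = true :: unaryCode a := rfl

theorem unaryCode_append_inj {a b : ℕ} {x y : List Bool} :
    unaryCode a ++ x = unaryCode b ++ y ↔ a = b ∧ x = y := by
  induction a generalizing b with
  | zero => cases b <;> simp [unaryCode_succ]
  | succ a ih => cases b <;> simp [unaryCode_succ, ih]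

namespace CounterProg

open Computability Function Relation

/-- Words that write the same unary code on the two tapes of the register `i`. -/
def transferLang (i : ℕ) : Language (ℕ × Bool) :=
  {[(2 * i, true), (2 * i + 1, true)]}∗ * {[(2 * i, false), (2 * i + 1, false)]}

/-- The word that writes the code of `a` on the two tapes of the register `i`. -/
def transferWord (i a : ℕ) : List (ℕ × Bool) :=
  (List.replicate a [(2 * i, true), (2 * i + 1, true)]).flatten ++
    [(2 * i, false), (2 * i + 1, false)]

theorem mem_transferLang {i : ℕ} {w : List (ℕ × Bool)} :
    w ∈ transferLang i ↔ ∃ a, w = transferWord i a := by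
  constructor
  · rintro ⟨_, ⟨W, rfl, hW⟩, _, rfl, rfl⟩
    exact ⟨W.length, by rw [transferWord, ← List.eq_replicate_of_mem hW]⟩
  · rintro ⟨a, rfl⟩
    exact ⟨_, ⟨_, rfl, fun y hy => List.eq_of_mem_replicate hy⟩, _, rfl, rfl⟩

@[simp]
theorem tapeContent_transferWord (j i a : ℕ) : tapeContent j (transferWord i a) =
    if j = 2 * i ∨ j = 2 * i + 1 then unaryCode a else [] := by
  induction a with
  | zero => simp [transferWord]; grind
  | succ a ih =>
    simp only [transferWord, List.replicate_succ, List.flatten_cons, List.append_assoc] at ih ⊢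
    rw [tapeContent_append, ih, unaryCode_succ]
    simp
    grind

theorem fst_of_mem_transferWord {i a : ℕ} {x : ℕ × Bool} (hx : x ∈ transferWord i a) :
    x.1 = 2 * i ∨ x.1 = 2 * i + 1 := by
  simp only [transferWord, List.mem_append, List.mem_flatten, List.mem_replicate] at hx
  rcases hx with ⟨_, ⟨-, rfl⟩, hx⟩ | hx <;> simp at hx <;> grind

/-- The words that describe the runs of a program: for each register `i`, the codes of its
successive values are written on the tape `2 * i` when they are used up, and on the tape
`2 * i + 1` when they are produced. -/
def lang : CounterProg → Language (ℕ × Bool)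
  | skip => 1
  | inc i => {[(2 * i + 1, true)]} * transferLang i
  | dec i => {[(2 * i, true)]} * transferLang i
  | zero i => {transferWord i 0}
  | seq P Q => P.lang * Q.lang
  | star P => P.lang∗

theorem isRegular_transferLang (i : ℕ) : (transferLang i).IsRegular :=
  (Language.IsRegular.of_finite (Set.finite_singleton _)).kstar.mul
    (.of_finite (Set.finite_singleton _))

theorem isRegular_lang (P : CounterProg) : P.lang.IsRegular := by
  induction P with
  | skip => exact .of_finite (Set.finite_singleton _)
  | inc i => exact .mul (.of_finite (Set.finite_singleton _)) (isRegular_transferLang i)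
  | dec i => exact .mul (.of_finite (Set.finite_singleton _)) (isRegular_transferLang i)
  | zero i => exact .of_finite (Set.finite_singleton _)
  | seq P Q hP hQ => exact hP.mul hQ
  | star P hP => exact hP.kstar

theorem mem_lang_inc {i : ℕ} {w : List (ℕ × Bool)} :
    w ∈ (inc i).lang ↔ ∃ a, w = (2 * i + 1, true) :: transferWord i a := by
  constructor
  · rintro ⟨_, rfl, _, h, rfl⟩
    obtain ⟨a, rfl⟩ := mem_transferLang.1 h
    exact ⟨a, rfl⟩
  · rintro ⟨a, rfl⟩
    exact ⟨_, rfl, _, mem_transferLang.2 ⟨a, rfl⟩, rfl⟩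

theorem mem_lang_dec {i : ℕ} {w : List (ℕ × Bool)} :
    w ∈ (dec i).lang ↔ ∃ a, w = (2 * i, true) :: transferWord i a := by
  constructor
  · rintro ⟨_, rfl, _, h, rfl⟩
    obtain ⟨a, rfl⟩ := mem_transferLang.1 h
    exact ⟨a, rfl⟩
  · rintro ⟨a, rfl⟩
    exact ⟨_, rfl, _, mem_transferLang.2 ⟨a, rfl⟩, rfl⟩

theorem exists_fst_lt_of_mem_lang (P : CounterProg) :
    ∃ K, 0 < K ∧ ∀ w ∈ P.lang, ∀ a ∈ w, a.1 < 2 * K := by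
  induction P with
  | skip => exact ⟨1, one_pos, fun w hw => by rw [(Language.mem_one w).1 hw]; simp⟩
  | inc i =>
    refine ⟨i + 1, by omega, fun w hw a ha => ?_⟩
    obtain ⟨b, rfl⟩ := mem_lang_inc.1 hw
    rcases List.mem_cons.1 ha with rfl | ha
    · simp only; omega
    · have := fst_of_mem_transferWord ha; omega
  | dec i =>
    refine ⟨i + 1, by omega, fun w hw a ha => ?_⟩
    obtain ⟨b, rfl⟩ := mem_lang_dec.1 hw
    rcases List.mem_cons.1 ha with rfl | ha
    · simp only; omega
    · have := fst_of_mem_transferWord ha; omega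
  | zero i =>
    refine ⟨i + 1, by omega, fun w hw a ha => ?_⟩
    obtain rfl : w = transferWord i 0 := hw
    have := fst_of_mem_transferWord ha; omega
  | seq P Q hP hQ =>
    obtain ⟨K, hK, hP⟩ := hP
    obtain ⟨M, -, hQ⟩ := hQ
    refine ⟨K + M, by omega, ?_⟩
    rintro _ ⟨u, hu, v, hv, rfl⟩ a ha
    rcases List.mem_append.1 ha with ha | ha
    · have := hP u hu a ha; omega
    · have := hQ v hv a ha; omega
  | star P hP =>
    obtain ⟨K, hK, hP⟩ := hP
    refine ⟨K, hK, ?_⟩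
    rintro _ ⟨W, rfl, hW⟩ a ha
    obtain ⟨w, hw, ha⟩ := List.mem_flatten.1 ha
    exact hP w (hW w hw) a ha

theorem exists_mem_lang {P : CounterProg} {s s' : ℕ → ℕ} (h : s' ∈ P.run s) :
    ∃ w ∈ P.lang, ∀ i, unaryCode (s i) ++ tapeContent (2 * i + 1) w =
      tapeContent (2 * i) w ++ unaryCode (s' i) := by
  induction P generalizing s s' with
  | skip =>
    obtain rfl : s' = s := h
    exact ⟨[], rfl, by simp⟩
  | inc i =>
    obtain rfl : s' = _ := h
    refine ⟨_, mem_lang_inc.2 ⟨s i, rfl⟩, fun j => ?_⟩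
    by_cases hj : i = j
    · subst hj
      simp [unaryCode_succ]
    · have h1 : ¬ (2 * i + 1 = 2 * j) := by omega
      have h2 : ¬ (j = i) := by omega
      have h3 : ¬ (2 * j = 2 * i + 1) := by omega
      have h4 : ¬ (2 * j + 1 = 2 * i) := by omega
      simp [hj, h1, h2, h3, h4]
  | dec i =>
    obtain ⟨h0, rfl⟩ := h
    obtain ⟨a, ha⟩ := Nat.exists_eq_succ_of_ne_zero h0
    refine ⟨_, mem_lang_dec.2 ⟨a, rfl⟩, fun j => ?_⟩
    by_cases hj : i = j
    · subst hj
      simp [unaryCode_succ, ha]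
    · have h1 : ¬ (2 * i = 2 * j + 1) := by omega
      have h2 : ¬ (j = i) := by omega
      have h3 : ¬ (2 * j = 2 * i + 1) := by omega
      have h4 : ¬ (2 * j + 1 = 2 * i) := by omega
      simp [hj, h1, h2, h3, h4]
  | zero i =>
    obtain ⟨h0, rfl⟩ := h
    refine ⟨_, rfl, fun j => ?_⟩
    by_cases hj : i = j
    · subst hj
      simp [h0]
    · have h2 : ¬ (j = i) := by omega
      have h3 : ¬ (2 * j = 2 * i + 1) := by omega
      have h4 : ¬ (2 * j + 1 = 2 * i) := by omega
      simp [h2, h3, h4]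
  | seq P Q hP hQ =>
    obtain ⟨t, h1, h2⟩ := h
    obtain ⟨u, hu, hu'⟩ := hP h1
    obtain ⟨v, hv, hv'⟩ := hQ h2
    refine ⟨u ++ v, ⟨u, hu, v, hv, rfl⟩, fun i => ?_⟩
    rw [tapeContent_append, tapeContent_append, ← List.append_assoc, hu', List.append_assoc, hv',
      List.append_assoc]
  | star P hP =>
    change ReflTransGen (fun a b => b ∈ P.run a) s s' at h
    induction h with
    | refl => exact ⟨[], Language.nil_mem_kstar _, by simp⟩
    | tail _ h ih =>
      obtain ⟨_, ⟨W, rfl, hW⟩, hu'⟩ := ih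
      obtain ⟨v, hv, hv'⟩ := hP h
      refine ⟨W.flatten ++ v, ⟨W ++ [v], by simp, ?_⟩, fun i => ?_⟩
      · simpa [or_imp, forall_and, hv] using hW
      · rw [tapeContent_append, tapeContent_append, ← List.append_assoc, hu', List.append_assoc,
          hv', List.append_assoc]

theorem exists_mem_run {P : CounterProg} {w : List (ℕ × Bool)} (hw : w ∈ P.lang)
    {x y : ℕ → List Bool} {s : ℕ → ℕ}
    (h : ∀ i, unaryCode (s i) ++ (tapeContent (2 * i + 1) w ++ y i) =
      tapeContent (2 * i) w ++ x i) :
    ∃ s' ∈ P.run s, ∀ i, x i = unaryCode (s' i) ++ y i := by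
  induction P generalizing w x y s with
  | skip =>
    obtain rfl : w = [] := hw
    exact ⟨s, rfl, fun i => by simpa using (h i).symm⟩
  | inc i =>
    obtain ⟨a, rfl⟩ := mem_lang_inc.1 hw
    refine ⟨_, rfl, fun j => ?_⟩
    have := h j
    by_cases hj : i = j
    · subst hj
      simp [unaryCode_append_inj] at this
      simp [unaryCode_succ, this.1, ← this.2]
    · have h1 : ¬ (2 * i + 1 = 2 * j) := by omega
      have h2 : ¬ (j = i) := by omega
      have h3 : ¬ (2 * j = 2 * i + 1) := by omega
      have h4 : ¬ (2 * j + 1 = 2 * i) := by omega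
      simpa [hj, h1, h2, h3, h4] using this.symm
  | dec i =>
    obtain ⟨a, rfl⟩ := mem_lang_dec.1 hw
    have hi := h i
    simp only [tapeContent_cons, tapeContent_transferWord, if_true, true_or, or_true,
      ← unaryCode_succ] at hi
    rw [if_neg (by omega), unaryCode_append_inj] at hi
    refine ⟨_, ⟨by omega, rfl⟩, fun j => ?_⟩
    have := h j
    by_cases hj : i = j
    · subst hj
      simp [hi.1, ← hi.2]
    · have h1 : ¬ (2 * i = 2 * j + 1) := by omega
      have h2 : ¬ (j = i) := by omega
      have h3 : ¬ (2 * j = 2 * i + 1) := by omega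
      have h4 : ¬ (2 * j + 1 = 2 * i) := by omega
      simpa [hj, h1, h2, h3, h4] using this.symm
  | zero i =>
    obtain rfl : w = transferWord i 0 := hw
    have hi := h i
    simp only [tapeContent_transferWord, true_or, or_true, if_true, unaryCode_append_inj] at hi
    refine ⟨s, ⟨hi.1, rfl⟩, fun j => ?_⟩
    have := h j
    by_cases hj : i = j
    · subst hj
      simp [hi.1, ← hi.2]
    · have h2 : ¬ (j = i) := by omega
      have h3 : ¬ (2 * j = 2 * i + 1) := by omega
      have h4 : ¬ (2 * j + 1 = 2 * i) := by omega
      simpa [h2, h3, h4] using this.symm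
  | seq P Q hP hQ =>
    obtain ⟨u, hu, v, hv, rfl⟩ := hw
    obtain ⟨t, ht, htx⟩ := hP hu (y := fun i => tapeContent (2 * i + 1) v ++ y i)
      (x := fun i => tapeContent (2 * i) v ++ x i) (s := s) fun i => by simpa using h i
    obtain ⟨s', hs', hx⟩ := hQ hv fun i => (htx i).symm
    exact ⟨s', ⟨t, ht, hs'⟩, hx⟩
  | star P hP =>
    obtain ⟨W, rfl, hW⟩ := hw
    induction W generalizing s with
    | nil => exact ⟨s, .refl, fun i => by simpa using (h i).symm⟩
    | cons w W ih =>
      obtain ⟨t, ht, htx⟩ := hP (hW w (by simp))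
        (y := fun i => tapeContent (2 * i + 1) W.flatten ++ y i)
        (x := fun i => tapeContent (2 * i) W.flatten ++ x i) (s := s) fun i => by simpa using h i
      obtain ⟨s', hs', hx⟩ := ih (fun z hz => hW z (by simp [hz])) fun i => (htx i).symm
      exact ⟨s', .head ht hs', hx⟩

end CounterProg

namespace CounterProg

open Computability Function

/-- Words in which each letter on a tape `2 * i` is followed by the same letter on the tape
`2 * i + 1`. -/
def diagLang (K : ℕ) : Language (ℕ × Bool) :=
  ({w | ∃ i < K, ∃ b, w = [(2 * i, b), (2 * i + 1, b)]} : Set (List (ℕ × Bool)))∗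

theorem isRegular_diagLang (K : ℕ) : (diagLang K).IsRegular := by
  refine .kstar (.of_finite (Set.Finite.subset
    ((Set.finite_Iio K).image2 (fun i b => [(2 * i, b), (2 * i + 1, b)])
      (Set.finite_univ (α := Bool))) ?_))
  rintro _ ⟨i, hi, b, rfl⟩
  exact ⟨i, hi, b, trivial, rfl⟩

theorem fst_lt_of_mem_diagLang {K : ℕ} {w : List (ℕ × Bool)} (hw : w ∈ diagLang K)
    {a : ℕ × Bool} (ha : a ∈ w) : a.1 < 2 * K := by
  obtain ⟨W, rfl, hW⟩ := hw
  obtain ⟨u, hu, ha⟩ := List.mem_flatten.1 ha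
  obtain ⟨i, hi, b, rfl⟩ := hW u hu
  simp only [List.mem_cons, List.not_mem_nil, or_false] at ha
  rcases ha with rfl | rfl <;> simp only <;> omega

theorem tapeContent_eq_of_mem_diagLang {K : ℕ} {w : List (ℕ × Bool)} (hw : w ∈ diagLang K)
    (j : ℕ) : tapeContent (2 * j) w = tapeContent (2 * j + 1) w := by
  obtain ⟨W, rfl, hW⟩ := hw
  induction W with
  | nil => rfl
  | cons w W ih =>
    obtain ⟨i, hi, b, rfl⟩ := hW w (by simp)
    have := ih fun z hz => hW z (by simp [hz])
    rw [List.flatten_cons, tapeContent_append, tapeContent_append, this]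
    congr 1
    have h3 : ¬ (2 * i + 1 = 2 * j) := by omega
    have h4 : ¬ (2 * i = 2 * j + 1) := by omega
    simp [h3, h4]

theorem exists_mem_diagLang {K : ℕ} {w : List (ℕ × Bool)} (hw : ∀ a ∈ w, a.1 < 2 * K)
    (h : ∀ i, tapeContent (2 * i) w = tapeContent (2 * i + 1) w) :
    ∃ v ∈ diagLang K, ∀ j, tapeContent j w = tapeContent j v := by
  have block : ∀ i < K, ∀ β : List Bool, ∃ u ∈ diagLang K,
      ∀ j, tapeContent j u = if j = 2 * i ∨ j = 2 * i + 1 then β else [] := by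
    intro i hi β
    refine ⟨(β.map fun b => [(2 * i, b), (2 * i + 1, b)]).flatten, ⟨_, rfl, ?_⟩, fun j => ?_⟩
    · intro y hy
      obtain ⟨b, -, rfl⟩ := List.mem_map.1 hy
      exact ⟨i, hi, b, rfl⟩
    · induction β with
      | nil => simp
      | cons b β ih =>
        rw [List.map_cons, List.flatten_cons, tapeContent_append, ih]
        simp only [tapeContent_cons, tapeContent_nil]
        grind
  have key : ∀ M ≤ K, ∃ v ∈ diagLang K,
      ∀ j, tapeContent j v = if j < 2 * M then tapeContent j w else [] := by
    intro M
    induction M with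
    | zero => exact fun _ => ⟨[], Language.nil_mem_kstar _, by simp⟩
    | succ M ih =>
      intro hM
      obtain ⟨_, ⟨V, rfl, hV⟩, hv'⟩ := ih (by omega)
      obtain ⟨_, ⟨U, rfl, hU⟩, hu'⟩ := block M hM (tapeContent (2 * M) w)
      refine ⟨_, ⟨V ++ U, rfl, ?_⟩, fun j => ?_⟩
      · exact fun y hy => (List.mem_append.1 hy).elim (hV y) (hU y)
      · rw [List.flatten_append, tapeContent_append, hv', hu']
        have := h M
        grind
  obtain ⟨v, hv, hvw⟩ := key K le_rfl
  refine ⟨v, hv, fun j => ?_⟩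
  rw [hvw j]
  split_ifs with hj
  · rfl
  · exact tapeContent_eq_nil fun a ha => by have := hw a ha; omega

theorem tapeContent_map_range_two_mul (K j : ℕ) :
    tapeContent j ((List.range K).map fun i => (2 * i, false)) =
      if j < 2 * K ∧ j % 2 = 0 then [false] else [] := by
  induction K with
  | zero => simp
  | succ K ih =>
    rw [List.range_succ, List.map_append, tapeContent_append, ih]
    simp only [List.map_cons, List.map_nil, tapeContent_cons, tapeContent_nil]
    grind

theorem tapeContent_map_range_two_mul_add_one (K j : ℕ) :
    tapeContent j ((List.range K).map fun i => (2 * i + 1, false)) =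
      if j < 2 * K ∧ j % 2 = 1 then [false] else [] := by
  induction K with
  | zero => simp
  | succ K ih =>
    rw [List.range_succ, List.map_append, tapeContent_append, ih]
    simp only [List.map_cons, List.map_nil, tapeContent_cons, tapeContent_nil]
    grind

/-- The domain of a partial recursive function in terms of two regular languages: the
letters are bits placed on finitely many tapes, and it is asked whether some word of the first
language, preceded by a unary code of the argument, and some word of the second language have
the same contents on all tapes. -/
theorem exists_isRegular_tapeContent_eq_iff_dom {f : ℕ →. ℕ} (hf : Partrec f) :
    ∃ (D : ℕ) (A B : Language (ℕ × Bool)), 1 < D ∧ A.IsRegular ∧ B.IsRegular ∧ [] ∉ A ∧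
      (∀ w ∈ A, ∀ a ∈ w, a.1 < D) ∧ (∀ w ∈ B, ∀ a ∈ w, a.1 < D) ∧
      ∀ x, (∃ u ∈ A, ∃ v ∈ B, ∀ j,
        tapeContent j (List.replicate (x + 1) (1, true) ++ u) = tapeContent j v) ↔ (f x).Dom := by
  obtain ⟨P, hP⟩ := exists_run_eq_zero_iff_dom hf
  obtain ⟨K, hK, hKP⟩ := exists_fst_lt_of_mem_lang P
  set p : List (ℕ × Bool) := (List.range K).map fun i => (2 * i + 1, false) with hp
  set e : List (ℕ × Bool) := (List.range K).map fun i => (2 * i, false) with he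
  have hlt : ∀ w ∈ P.lang, ∀ a ∈ p ++ w ++ e, a.1 < 2 * K := by
    intro w hw a ha
    simp only [hp, he, List.mem_append, List.mem_map, List.mem_range] at ha
    rcases ha with (⟨i, hi, rfl⟩ | ha) | ⟨i, hi, rfl⟩
    · simp only; omega
    · exact hKP w hw a ha
    · simp only; omega
  have hmem : ∀ {w}, w ∈ ({p} * P.lang * {e} : Language (ℕ × Bool)) ↔
      ∃ u ∈ P.lang, w = p ++ u ++ e := by
    intro w
    constructor
    · rintro ⟨_, ⟨_, rfl, u, hu, rfl⟩, _, rfl, rfl⟩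
      exact ⟨u, hu, rfl⟩
    · rintro ⟨u, hu, rfl⟩
      exact ⟨_, ⟨_, rfl, u, hu, rfl⟩, _, rfl, rfl⟩
  refine ⟨2 * K, {p} * P.lang * {e}, diagLang K, by omega,
    ((Language.IsRegular.of_finite (Set.finite_singleton _)).mul P.isRegular_lang).mul
      (.of_finite (Set.finite_singleton _)), isRegular_diagLang K, fun h => ?_, fun w hw => ?_,
    fun w hw a ha => fst_lt_of_mem_diagLang hw ha, fun x => ?_⟩
  · obtain ⟨u, -, hu⟩ := hmem.1 h
    simp [hp, hK.ne'] at hu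
  · obtain ⟨u, hu, rfl⟩ := hmem.1 hw
    exact hlt u hu
  set s : ℕ → ℕ := update 0 0 (x + 1) with hs
  have h0 : ∀ u i, tapeContent (2 * i) (List.replicate (x + 1) (1, true) ++ (p ++ u ++ e)) =
      tapeContent (2 * i) u ++ if i < K then [false] else [] := by
    intro u i
    have h1 : ¬ (1 = 2 * i) := by omega
    simp [hp, he, tapeContent_map_range_two_mul, tapeContent_map_range_two_mul_add_one,
      tapeContent_replicate, h1]
  have h1 : ∀ u i, tapeContent (2 * i + 1) (List.replicate (x + 1) (1, true) ++ (p ++ u ++ e)) =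
      if i < K then unaryCode (s i) ++ tapeContent (2 * i + 1) u
        else tapeContent (2 * i + 1) u := by
    intro u i
    have h2 : (2 * i + 1) % 2 = 1 := by omega
    have h3 : 2 * i + 1 < 2 * K ↔ i < K := by omega
    simp only [hp, he, tapeContent_append, tapeContent_map_range_two_mul,
      tapeContent_map_range_two_mul_add_one, tapeContent_replicate, h2, h3, hs, unaryCode,
      update_apply]
    rcases eq_or_ne i 0 with rfl | hi
    · simp [hK]
    · by_cases hiK : i < K <;> simp [hi, hiK]
  have hnil : ∀ u ∈ P.lang, ∀ j ≥ 2 * K, tapeContent j u = [] := fun u hu j hj =>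
    tapeContent_eq_nil fun a ha => by have := hKP u hu a ha; omega
  rw [← hP]
  constructor
  · rintro ⟨_, hu', v, hv, huv⟩
    obtain ⟨u, hu, rfl⟩ := hmem.1 hu'
    have key : ∀ i, unaryCode (s i) ++ (tapeContent (2 * i + 1) u ++ []) =
        tapeContent (2 * i) u ++ [false] := by
      intro i
      have := tapeContent_eq_of_mem_diagLang hv i
      rw [← huv, ← huv, h0, h1] at this
      by_cases hi : i < K
      · simpa [hi] using this.symm
      · rw [hnil u hu _ (by omega), hnil u hu _ (by omega)]
        have : s i = 0 := by rw [hs, update_of_ne (by omega)]; rfl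
        simp [this]
    obtain ⟨s', hs', h⟩ := exists_mem_run hu (x := fun _ => [false]) (y := fun _ => []) key
    convert hs'
    ext i
    have := h i
    rw [← unaryCode_zero, ← List.append_nil (unaryCode 0), unaryCode_append_inj] at this
    exact this.1
  · intro h
    obtain ⟨u, hu, huv⟩ := exists_mem_lang h
    obtain ⟨v, hv, h⟩ := exists_mem_diagLang (K := K)
      (w := List.replicate (x + 1) (1, true) ++ (p ++ u ++ e)) (by
        intro a ha
        rcases List.mem_append.1 ha with ha | ha
        · rw [List.eq_of_mem_replicate ha]; simp only; omega
        · exact hlt u hu a ha) (by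
        intro i
        rw [h0, h1]
        by_cases hi : i < K
        · simpa [hi] using (huv i).symm
        · simp [hi, hnil u hu (2 * i) (by omega), hnil u hu (2 * i + 1) (by omega)])
    exact ⟨_, hmem.2 ⟨u, hu, rfl⟩, v, hv, h⟩

end CounterProg

section

open Set Topology Bornology

/-- The contraction of `ℝ^(D+1)` assigned to the bit `a.2` on the tape `a.1`. -/
noncomputable def letterMap (D : ℕ) (a : ℕ × Bool) :
    EuclideanSpace ℝ (Fin (D + 1)) ≃ₜ EuclideanSpace ℝ (Fin (D + 1)) where
  toFun x := WithLp.toLp 2 fun i =>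
    if (i : ℕ) = a.1 + 1 then x i / 16 + (if a.2 then x 0 / 8 else 0) else x i / 4
  invFun x := WithLp.toLp 2 fun i =>
    if (i : ℕ) = a.1 + 1 then 16 * x i - (if a.2 then 8 * x 0 else 0) else 4 * x i
  left_inv x := by
    ext i
    by_cases h : (i : ℕ) = a.1 + 1 <;> cases a.2 <;> simp [h] <;> ring
  right_inv x := by
    ext i
    by_cases h : (i : ℕ) = a.1 + 1 <;> cases a.2 <;> simp [h]
    ring
  continuous_toFun := by
    refine (PiLp.continuous_toLp 2 _).comp (continuous_pi fun i => ?_)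
    split_ifs <;> fun_prop
  continuous_invFun := by
    refine (PiLp.continuous_toLp 2 _).comp (continuous_pi fun i => ?_)
    split_ifs <;> fun_prop

theorem letterMap_apply (D : ℕ) (a : ℕ × Bool) (x : EuclideanSpace ℝ (Fin (D + 1)))
    (i : Fin (D + 1)) : letterMap D a x i =
      if (i : ℕ) = a.1 + 1 then x i / 16 + (if a.2 then x 0 / 8 else 0) else x i / 4 := rfl

theorem letterMap_apply_zero (D : ℕ) (a : ℕ × Bool) (x : EuclideanSpace ℝ (Fin (D + 1))) :
    letterMap D a x 0 = x 0 / 4 := by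
  simp [letterMap_apply]

@[simp]
theorem letterMap_zero (D : ℕ) (a : ℕ × Bool) : letterMap D a 0 = 0 := by
  ext i
  simp [letterMap_apply]

theorem letterMap_sub (D : ℕ) (a : ℕ × Bool) (x y : EuclideanSpace ℝ (Fin (D + 1))) :
    letterMap D a (x - y) = letterMap D a x - letterMap D a y := by
  ext i
  simp only [letterMap_apply, PiLp.sub_apply]
  split_ifs <;> ring

theorem norm_letterMap_le (D : ℕ) (a : ℕ × Bool) (x : EuclideanSpace ℝ (Fin (D + 1))) :
    ‖letterMap D a x‖ ≤ 1 / 2 * ‖x‖ := by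
  refine le_of_sq_le_sq ?_ (by positivity)
  rw [mul_pow, EuclideanSpace.real_norm_sq_eq, EuclideanSpace.real_norm_sq_eq]
  have h : ∀ i, letterMap D a x i ^ 2 ≤
      x i ^ 2 / 16 + if (i : ℕ) = a.1 + 1 then x 0 ^ 2 / 32 else 0 := by
    intro i
    rw [letterMap_apply]
    split_ifs <;> nlinarith [sq_nonneg (x i / 16 - x 0 / 8), sq_nonneg (x i), sq_nonneg (x 0)]
  have h0 : x 0 ^ 2 ≤ ∑ i, x i ^ 2 :=
    Finset.single_le_sum (f := fun i => x i ^ 2) (fun i _ => sq_nonneg _) (Finset.mem_univ 0)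
  have h1 : ∑ i : Fin (D + 1), (if (i : ℕ) = a.1 + 1 then x 0 ^ 2 / 32 else 0) ≤ x 0 ^ 2 / 32 := by
    by_cases ha : a.1 + 1 < D + 1
    · rw [Finset.sum_eq_single ⟨a.1 + 1, ha⟩ (fun i _ hi => if_neg fun h => hi (Fin.ext h))
        (fun h => absurd (Finset.mem_univ _) h)]
      simp
    · rw [Finset.sum_eq_zero fun i _ => if_neg (by have := i.2; omega)]
      positivity
  calc ∑ i, letterMap D a x i ^ 2 ≤ _ := Finset.sum_le_sum fun i _ => h i
    _ ≤ _ := by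
      rw [Finset.sum_add_distrib, ← Finset.sum_div]
      nlinarith

theorem lipschitzWith_letterMap (D : ℕ) (a : ℕ × Bool) :
    LipschitzWith (1 / 2) (letterMap D a) := by
  refine LipschitzWith.of_dist_le_mul fun x y => ?_
  rw [dist_eq_norm, dist_eq_norm, ← letterMap_sub]
  simpa using norm_letterMap_le D a (x - y)

/-- The composition of the maps assigned to the letters of `w`. -/
noncomputable def wordMap (D : ℕ) (w : List (ℕ × Bool)) (x : EuclideanSpace ℝ (Fin (D + 1))) :
    EuclideanSpace ℝ (Fin (D + 1)) :=
  w.foldr (fun a x => letterMap D a x) x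

@[simp]
theorem wordMap_nil (D : ℕ) (x : EuclideanSpace ℝ (Fin (D + 1))) : wordMap D [] x = x := rfl

@[simp]
theorem wordMap_cons (D : ℕ) (a : ℕ × Bool) (w : List (ℕ × Bool))
    (x : EuclideanSpace ℝ (Fin (D + 1))) :
    wordMap D (a :: w) x = letterMap D a (wordMap D w x) := rfl

theorem norm_wordMap_le (D : ℕ) (w : List (ℕ × Bool)) (x : EuclideanSpace ℝ (Fin (D + 1))) :
    ‖wordMap D w x‖ ≤ ‖x‖ := by
  induction w with
  | nil => simp
  | cons a w ih =>
    have := norm_letterMap_le D a (wordMap D w x)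
    have := norm_nonneg (wordMap D w x)
    rw [wordMap_cons]
    linarith

theorem isOpenMap_wordMap (D : ℕ) (w : List (ℕ × Bool)) : IsOpenMap (wordMap D w) := by
  induction w with
  | nil => exact IsOpenMap.id
  | cons a w ih => exact (letterMap D a).isOpenMap.comp ih

/-- The effect of the bits `β` on a coordinate `y`, relative to the scale `t`. -/
noncomputable def bitsMap (t : ℝ) (β : List Bool) (y : ℝ) : ℝ :=
  β.foldr (fun b y => (y + if b then 2 * t else 0) / 4) y

@[simp]
theorem bitsMap_nil (t y : ℝ) : bitsMap t [] y = y := rfl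

@[simp]
theorem bitsMap_cons (t y : ℝ) (b : Bool) (β : List Bool) :
    bitsMap t (b :: β) y = (bitsMap t β y + if b then 2 * t else 0) / 4 := rfl

theorem bitsMap_mem_Ioc {t y : ℝ} (hy : y ∈ Ioc 0 t) (β : List Bool) :
    bitsMap t β y ∈ Ioc 0 t := by
  induction β with
  | nil => exact hy
  | cons b β ih =>
    have := ih.1
    have := ih.2
    cases b <;> simp <;> constructor <;> linarith

theorem eq_of_bitsMap_eq {t y z : ℝ} {β γ : List Bool} (ht : 0 < t) (hy : y ∈ Ioc (3 / 4 * t) t)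
    (hz : z ∈ Ioc (3 / 4 * t) t) (h : bitsMap t β y = bitsMap t γ z) : β = γ := by
  have hy' : y ∈ Ioc 0 t := ⟨by linarith [hy.1], hy.2⟩
  have hz' : z ∈ Ioc 0 t := ⟨by linarith [hz.1], hz.2⟩
  induction β generalizing γ with
  | nil =>
    cases γ with
    | nil => rfl
    | cons c γ =>
      have hγ := bitsMap_mem_Ioc hz' γ
      have := hγ.2
      have := hy.1
      cases c <;> simp at h <;> linarith
  | cons b β ih =>
    have hβ := bitsMap_mem_Ioc hy' β
    have := hβ.1
    have := hβ.2
    cases γ with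
    | nil =>
      have := hz.1
      cases b <;> simp at h <;> linarith
    | cons c γ =>
      have hγ := bitsMap_mem_Ioc hz' γ
      have := hγ.1
      have := hγ.2
      have hbc : b = c := by
        cases b <;> cases c <;> simp at h ⊢ <;> linarith
      subst hbc
      rw [ih (by simpa using h)]

theorem wordMap_apply_zero (D : ℕ) (w : List (ℕ × Bool)) (x : EuclideanSpace ℝ (Fin (D + 1))) :
    wordMap D w x 0 = (1 / 4) ^ w.length * x 0 := by
  induction w with
  | nil => simp
  | cons a w ih => rw [wordMap_cons, letterMap_apply_zero, ih, List.length_cons, pow_succ]; ring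

theorem wordMap_apply_succ {D : ℕ} (w : List (ℕ × Bool)) (x : EuclideanSpace ℝ (Fin (D + 1)))
    (j : Fin D) : wordMap D w x j.succ =
      (1 / 4) ^ w.length * bitsMap (x 0) (tapeContent j w) (x j.succ) := by
  induction w with
  | nil => simp
  | cons a w ih =>
    rw [wordMap_cons, letterMap_apply, ih, List.length_cons, pow_succ, tapeContent_cons,
      wordMap_apply_zero]
    by_cases h : a.1 = j
    · cases a.2 <;> simp [h] <;> ring
    · have h' : ¬ (j : ℕ) = a.1 := fun h' => h h'.symm
      simp [h, h']
      ring

/-- A box on which the maps of different words can be told apart. -/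
def baseBox (D : ℕ) : Set (EuclideanSpace ℝ (Fin (D + 1))) :=
  {x | ∀ i, x i ∈ Icc (if i = 0 then 10 else 9 : ℝ) ((if i = 0 then 10 else 9) + 1)}

theorem isClosed_baseBox (D : ℕ) : IsClosed (baseBox D) := by
  simp only [baseBox, ofPred_forall]
  exact isClosed_iInter fun i => isClosed_Icc.preimage (by fun_prop)

theorem tapeContent_eq_of_wordMap_eq {D : ℕ} {u v : List (ℕ × Bool)} (hu : ∀ a ∈ u, a.1 < D)
    (hv : ∀ a ∈ v, a.1 < D) {x y : EuclideanSpace ℝ (Fin (D + 1))} (hx : x ∈ baseBox D)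
    (hy : y ∈ baseBox D) (h : wordMap D u x = wordMap D v y) (j : ℕ) :
    tapeContent j u = tapeContent j v := by
  have hx0 : 10 ≤ x 0 ∧ x 0 ≤ 11 := by have := hx 0; norm_num at this; exact this
  have hy0 : 10 ≤ y 0 ∧ y 0 ≤ 11 := by have := hy 0; norm_num at this; exact this
  have h0 : (1 / 4 : ℝ) ^ u.length * x 0 = (1 / 4) ^ v.length * y 0 := by
    rw [← wordMap_apply_zero, ← wordMap_apply_zero, h]
  have hlt : ∀ {m n : ℕ} {s t : ℝ}, 10 ≤ s ∧ s ≤ 11 → 10 ≤ t ∧ t ≤ 11 →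
      (1 / 4 : ℝ) ^ m * s = (1 / 4) ^ n * t → ¬ m < n := by
    intro m n s t hs ht hst hmn
    have h1 : (1 / 4 : ℝ) ^ n ≤ (1 / 4) ^ (m + 1) :=
      pow_le_pow_of_le_one (by norm_num) (by norm_num) hmn
    have h2 : (0 : ℝ) < (1 / 4) ^ m := by positivity
    rw [pow_succ] at h1
    nlinarith
  have hlen : u.length = v.length :=
    le_antisymm (not_lt.1 (hlt hy0 hx0 h0.symm)) (not_lt.1 (hlt hx0 hy0 h0))
  have hpos : (0 : ℝ) < (1 / 4) ^ v.length := by positivity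
  rw [hlen] at h0
  have hxy : x 0 = y 0 := mul_left_cancel₀ hpos.ne' h0
  by_cases hj : j < D
  · have hxj : 9 ≤ x (Fin.succ ⟨j, hj⟩) ∧ x (Fin.succ ⟨j, hj⟩) ≤ 10 := by
      have := hx (Fin.succ ⟨j, hj⟩); norm_num at this; exact this
    have hyj : 9 ≤ y (Fin.succ ⟨j, hj⟩) ∧ y (Fin.succ ⟨j, hj⟩) ≤ 10 := by
      have := hy (Fin.succ ⟨j, hj⟩); norm_num at this; exact this
    have hj' : wordMap D u x (Fin.succ ⟨j, hj⟩) = wordMap D v y (Fin.succ ⟨j, hj⟩) := by rw [h]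
    rw [wordMap_apply_succ, wordMap_apply_succ, hlen, hxy] at hj'
    exact eq_of_bitsMap_eq (by linarith) ⟨by linarith, by linarith⟩ ⟨by linarith, by linarith⟩
      (mul_left_cancel₀ hpos.ne' hj')
  · rw [tapeContent_eq_nil fun a ha => by have := hu a ha; omega,
      tapeContent_eq_nil fun a ha => by have := hv a ha; omega]

theorem wordMap_eq_of_tapeContent_eq {D : ℕ} {u v : List (ℕ × Bool)} (hu : ∀ a ∈ u, a.1 < D)
    (hv : ∀ a ∈ v, a.1 < D) (h : ∀ j, tapeContent j u = tapeContent j v) :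
    wordMap D u = wordMap D v := by
  ext x i
  have hlen := length_eq_of_tapeContent_eq hu hv h
  refine Fin.cases ?_ (fun j => ?_) i
  · rw [wordMap_apply_zero, wordMap_apply_zero, hlen]
  · rw [wordMap_apply_succ, wordMap_apply_succ, hlen, h]

/-- The maps that cut the box into dyadic parts. -/
noncomputable def cubeMap {D : ℕ} (σ : Fin (D + 1) → Bool) (x : EuclideanSpace ℝ (Fin (D + 1))) :
    EuclideanSpace ℝ (Fin (D + 1)) :=
  WithLp.toLp 2 fun i => x i / 2 + ((if i = 0 then 10 else 9) + if σ i then 1 else 0) / 2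

theorem lipschitzWith_cubeMap {D : ℕ} (σ : Fin (D + 1) → Bool) :
    LipschitzWith (1 / 2) (cubeMap σ) := by
  refine LipschitzWith.of_dist_le_mul fun x y => ?_
  have : cubeMap σ x - cubeMap σ y = (1 / 2 : ℝ) • (x - y) := by
    ext i
    simp [cubeMap]
    ring
  rw [dist_eq_norm, dist_eq_norm, this, norm_smul]
  simp

theorem baseBox_eq_iUnion (D : ℕ) : baseBox D = ⋃ σ, cubeMap σ '' baseBox D := by
  ext x
  simp only [mem_iUnion, mem_image]
  constructor
  · intro hx
    refine ⟨fun i => decide (x i ≥ (if i = 0 then 10 else 9) + 1 / 2), WithLp.toLp 2 fun i =>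
      2 * x i - ((if i = 0 then 10 else 9) +
        if x i ≥ (if i = 0 then 10 else 9) + 1 / 2 then 1 else 0), fun i => ?_, ?_⟩
    · have := (hx i).1
      have := (hx i).2
      simp only
      split_ifs at * <;> constructor <;> linarith
    · ext i
      simp [cubeMap]
      ring
  · rintro ⟨σ, y, hy, rfl⟩ i
    have := (hy i).1
    have := (hy i).2
    simp only [cubeMap]
    cases σ i <;> simp only [Bool.false_eq_true, if_true, if_false] <;> constructor <;> linarith

theorem subset_baseBox {D : ℕ} {s : Set (EuclideanSpace ℝ (Fin (D + 1)))} (hs : IsCompact s)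
    (h : s = ⋃ σ, cubeMap σ '' s) : s ⊆ baseBox D := by
  intro x hx i
  have hc : ContinuousOn (fun y : EuclideanSpace ℝ (Fin (D + 1)) => y i) s := by fun_prop
  constructor
  · obtain ⟨y, hy, hmin⟩ := hs.exists_isMinOn ⟨x, hx⟩ hc
    refine le_trans ?_ (hmin hx)
    rw [h] at hy
    obtain ⟨σ, z, hz, rfl⟩ := mem_iUnion.1 hy
    have := hmin hz
    simp only [cubeMap, mem_ofPred_eq] at this ⊢
    split_ifs at this ⊢ <;> linarith
  · obtain ⟨y, hy, hmax⟩ := hs.exists_isMaxOn ⟨x, hx⟩ hc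
    refine (hmax hx).trans ?_
    rw [h] at hy
    obtain ⟨σ, z, hz, rfl⟩ := mem_iUnion.1 hy
    have := hmax hz
    simp only [cubeMap, mem_ofPred_eq] at this ⊢
    split_ifs at this ⊢ <;> linarith

/-- The words along the paths from a vertex to the vertex `0`. -/
inductive PathWord (E : ℕ → ℕ × Bool → ℕ → Prop) : ℕ → List (ℕ × Bool) → Prop
  | nil : PathWord E 0 []
  | cons {p p' : ℕ} {a : ℕ × Bool} {w : List (ℕ × Bool)} :
      E p a p' → PathWord E p' w → PathWord E p (a :: w)

/-- The equations satisfied by the attractors of the graph with the edge relation `E`, in which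
the vertex `0` only carries loops. -/
def IsSolution (D m : ℕ) (E : ℕ → ℕ × Bool → ℕ → Prop)
    (X : ℕ → Set (EuclideanSpace ℝ (Fin (D + 1)))) : Prop :=
  X 0 = ⋃ σ, cubeMap σ '' X 0 ∧
    ∀ p < m, p ≠ 0 → X p = ⋃ e ∈ {e : (ℕ × Bool) × ℕ | E p e.1 e.2}, letterMap D e.1 '' X e.2

section

variable {D m : ℕ} {E : ℕ → ℕ × Bool → ℕ → Prop}

theorem IsSolution.exists_pathWord {X : ℕ → Set (EuclideanSpace ℝ (Fin (D + 1)))} (hm : 0 < m)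
    (hE : ∀ p a p', E p a p' → p' < m) (hc : ∀ p < m, IsCompact (X p)) (hX : IsSolution D m E X)
    {p : ℕ} (hp : p < m) {x : EuclideanSpace ℝ (Fin (D + 1))} (hx : x ∈ X p) (hx0 : x 0 ≠ 0) :
    ∃ w, PathWord E p w ∧ x ∈ wordMap D w '' baseBox D := by
  obtain ⟨B, hB⟩ := ((finite_Iio m).isCompact_biUnion hc).exists_bound_of_continuousOn
    (f := fun y : EuclideanSpace ℝ (Fin (D + 1)) => y 0) (by fun_prop)
  have key : ∀ (N p : ℕ) (x : EuclideanSpace ℝ (Fin (D + 1))), p < m → x ∈ X p →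
      (1 / 4) ^ N * B < |x 0| → ∃ w, PathWord E p w ∧ x ∈ wordMap D w '' baseBox D := by
    intro N
    induction N with
    | zero =>
      intro p x hp hx h
      have := hB x (mem_biUnion hp hx)
      rw [Real.norm_eq_abs] at this
      linarith
    | succ N ih =>
      intro p x hp hx h
      rcases eq_or_ne p 0 with rfl | hp0
      · exact ⟨[], .nil, x, subset_baseBox (hc 0 hm) hX.1 hx, rfl⟩
      · rw [hX.2 p hp hp0] at hx
        obtain ⟨e, he, y, hy, rfl⟩ := mem_iUnion₂.1 hx
        rw [letterMap_apply_zero, abs_div, pow_succ] at h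
        norm_num at h
        obtain ⟨w, hw, z, hz, rfl⟩ := ih e.2 y (hE _ _ _ he) hy (by norm_num; linarith)
        exact ⟨e.1 :: w, .cons he hw, z, hz, rfl⟩
  have hxB : 0 ≤ B := (norm_nonneg _).trans (hB x (mem_biUnion hp hx))
  obtain ⟨N, hN⟩ := exists_pow_lt_of_lt_one (x := |x 0| / (B + 1)) (y := (1 / 4 : ℝ))
    (by positivity) (by norm_num)
  refine key N p x hp hx ?_
  rw [lt_div_iff₀ (by linarith)] at hN
  have : (0 : ℝ) ≤ (1 / 4) ^ N := by positivity
  linarith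

theorem interior_eq_empty_of_forall_zero {s : Set (EuclideanSpace ℝ (Fin (D + 1)))}
    (h : ∀ x ∈ s, x 0 = 0) : interior s = ∅ := by
  by_contra hne
  obtain ⟨x, hx⟩ := nonempty_iff_ne_empty.2 hne
  obtain ⟨ε, hε, hball⟩ := Metric.isOpen_iff.1 isOpen_interior x hx
  have h1 := h x (interior_subset hx)
  have h2 := h _ (interior_subset (hball
    (show x + EuclideanSpace.single 0 (ε / 2) ∈ Metric.ball x ε by
      simp [abs_of_pos hε, hε])))
  simp [h1] at h2
  exact hε.ne' h2

/-- An explicit solution of the equations. -/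
def pathSet (D : ℕ) (E : ℕ → ℕ × Bool → ℕ → Prop) (p : ℕ) :
    Set (EuclideanSpace ℝ (Fin (D + 1))) :=
  {x | (p ≠ 0 ∧ x = 0) ∨ ∃ w, PathWord E p w ∧ x ∈ wordMap D w '' baseBox D}

theorem image_subset_pathSet {p : ℕ} {w : List (ℕ × Bool)} (hw : PathWord E p w) :
    wordMap D w '' baseBox D ⊆ pathSet D E p :=
  fun _ hx => .inr ⟨w, hw, hx⟩

theorem baseBox_nonempty (D : ℕ) : (baseBox D).Nonempty :=
  ⟨WithLp.toLp 2 fun i => if i = 0 then 10 else 9, fun i => by simp⟩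

theorem isBounded_baseBox (D : ℕ) : IsBounded (baseBox D) := by
  have : baseBox D ⊆ WithLp.ofLp ⁻¹' Icc (fun _ => 9) (fun _ => 11) := by
    intro x hx
    refine ⟨fun i => ?_, fun i => ?_⟩ <;> have := hx i <;> split_ifs at this <;>
      simp only [mem_Icc] at this <;> linarith
  exact (((PiLp.antilipschitzWith_ofLp 2 _).isBounded_preimage (Metric.isBounded_Icc _ _))).subset
    this

theorem isCompact_closure_pathSet (p : ℕ) : IsCompact (closure (pathSet D E p)) := by
  obtain ⟨R, hR⟩ := (isBounded_baseBox D).exists_norm_le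
  refine (isBounded_iff_forall_norm_le.2 ⟨max R 0, ?_⟩).isCompact_closure
  rintro _ (⟨-, rfl⟩ | ⟨w, -, x, hx, rfl⟩)
  · simp
  · exact ((norm_wordMap_le D w x).trans (hR x hx)).trans (le_max_left _ _)

theorem pathSet_zero (hE : ∀ p a p', E p a p' → p ≠ 0) : pathSet D E 0 = baseBox D := by
  ext x
  constructor
  · rintro (⟨h, -⟩ | ⟨w, hw, hx⟩)
    · exact absurd rfl h
    · cases hw with
      | nil => simpa using hx
      | cons h _ => exact absurd rfl (hE _ _ _ h)
  · exact fun hx => .inr ⟨[], .nil, x, hx, rfl⟩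

theorem pathSet_eq_iUnion {p : ℕ} (hp : p ≠ 0) (h : ∃ a p', p' ≠ 0 ∧ E p a p') :
    pathSet D E p =
      ⋃ e ∈ {e : (ℕ × Bool) × ℕ | E p e.1 e.2}, letterMap D e.1 '' pathSet D E e.2 := by
  ext x
  simp only [mem_iUnion, exists_prop]
  constructor
  · rintro (⟨-, rfl⟩ | ⟨w, hw, hx⟩)
    · obtain ⟨a, p', hp', he⟩ := h
      exact ⟨(a, p'), he, 0, .inl ⟨hp', rfl⟩, by simp⟩
    · cases hw with
      | nil => exact absurd rfl hp
      | cons he hw =>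
        obtain ⟨y, hy, rfl⟩ := hx
        exact ⟨(_, _), he, _, .inr ⟨_, hw, y, hy, rfl⟩, rfl⟩
  · rintro ⟨e, he, _, (⟨-, rfl⟩ | ⟨w, hw, y, hy, rfl⟩), rfl⟩
    · exact .inl ⟨hp, by simp⟩
    · exact .inr ⟨e.1 :: w, .cons he hw, y, hy, rfl⟩

theorem nonempty_pathSet (hE : ∀ p a p', E p a p' → p ≠ 0) (p : ℕ) :
    (pathSet D E p).Nonempty := by
  rcases eq_or_ne p 0 with rfl | hp
  · rw [pathSet_zero hE]
    exact baseBox_nonempty D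
  · exact ⟨0, .inl ⟨hp, rfl⟩⟩

theorem isSolution_closure_pathSet (hE : ∀ p a p', E p a p' → p ≠ 0)
    (hfin : ∀ p, {e : (ℕ × Bool) × ℕ | E p e.1 e.2}.Finite)
    (h : ∀ p < m, p ≠ 0 → ∃ a p', p' ≠ 0 ∧ E p a p') :
    IsSolution D m E fun p => closure (pathSet D E p) := by
  constructor
  · simp only [pathSet_zero hE, (isClosed_baseBox D).closure_eq]
    exact baseBox_eq_iUnion D
  · intro p hp hp0
    change closure (pathSet D E p) = _
    rw [pathSet_eq_iUnion hp0 (h p hp hp0), (hfin p).closure_biUnion]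
    simp only [(letterMap D _).image_closure]

theorem interior_pathSet_inter_nonempty {p p' : ℕ} {u v : List (ℕ × Bool)} (hu : PathWord E p u)
    (hv : PathWord E p' v) (h : wordMap D u = wordMap D v) :
    (interior (closure (pathSet D E p) ∩ closure (pathSet D E p'))).Nonempty := by
  obtain ⟨x, hx⟩ : (interior (baseBox D)).Nonempty := by
    refine ⟨WithLp.toLp 2 fun i => (if i = 0 then 10 else 9) + 1 / 2, mem_interior.2
      ⟨{x | ∀ i, x i ∈ Ioo (if i = 0 then 10 else 9 : ℝ) ((if i = 0 then 10 else 9) + 1)},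
        fun y hy i => Ioo_subset_Icc_self (hy i), ?_, fun i => ⟨?_, ?_⟩⟩⟩
    · simp only [ofPred_forall]
      exact isOpen_iInter_of_finite fun i => isOpen_Ioo.preimage (by fun_prop)
    · simp
    · norm_num
  refine ⟨wordMap D u x, interior_maximal ?_ (isOpenMap_wordMap D u _ isOpen_interior)
    (mem_image_of_mem _ hx)⟩
  have hsub := image_mono (f := wordMap D u) (interior_subset (s := baseBox D))
  refine subset_inter (hsub.trans ((image_subset_pathSet hu).trans subset_closure)) ?_
  rw [h] at hsub ⊢
  exact hsub.trans ((image_subset_pathSet hv).trans subset_closure)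

/-- Whether the solutions at two vertices always have an intersection with empty interior is
decided by the words along the paths from these vertices. -/
theorem forall_interior_eq_empty_iff (hm : 0 < m)
    (hE : ∀ p a p', E p a p' → p ≠ 0 ∧ a.1 < D ∧ p' < m)
    (h : ∀ p < m, p ≠ 0 → ∃ a p', p' ≠ 0 ∧ E p a p') {q r : ℕ} (hq : q < m) (hr : r < m) :
    (∀ X : ℕ → Set (EuclideanSpace ℝ (Fin (D + 1))),
      (∀ p < m, (X p).Nonempty ∧ IsCompact (X p)) → IsSolution D m E X →
        interior (X q ∩ X r) = ∅) ↔
    ¬ ∃ u v, PathWord E q u ∧ PathWord E r v ∧ ∀ j, tapeContent j u = tapeContent j v := by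
  have hfst : ∀ {p w}, PathWord E p w → ∀ a ∈ w, a.1 < D := by
    intro p w hw
    induction hw with
    | nil => simp
    | cons he _ ih => exact List.forall_mem_cons.2 ⟨(hE _ _ _ he).2.1, ih⟩
  constructor
  · rintro hX ⟨u, v, hu, hv, huv⟩
    have hne := interior_pathSet_inter_nonempty (D := D) hu hv
      (wordMap_eq_of_tapeContent_eq (hfst hu) (hfst hv) huv)
    refine hne.ne_empty (hX _ (fun p _ => ⟨(nonempty_pathSet (fun p a p' he => (hE p a p' he).1)
      p).closure, isCompact_closure_pathSet p⟩) (isSolution_closure_pathSet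
      (fun p a p' he => (hE p a p' he).1) (fun p => ?_) h))
    refine Finite.subset (((finite_Iio D).prod (finite_univ (α := Bool))).prod (finite_Iio m)) ?_
    exact fun e he => ⟨⟨(hE _ _ _ he).2.1, trivial⟩, (hE _ _ _ he).2.2⟩
  · intro hno X hX hsol
    refine interior_eq_empty_of_forall_zero fun x hx => ?_
    by_contra hx0
    have hE' := fun p a p' he => (hE p a p' he).2.2
    obtain ⟨u, hu, y, hy, hyx⟩ :=
      hsol.exists_pathWord hm hE' (fun p hp => (hX p hp).2) hq hx.1 hx0
    obtain ⟨v, hv, z, hz, hzx⟩ :=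
      hsol.exists_pathWord hm hE' (fun p hp => (hX p hp).2) hr hx.2 hx0
    exact hno ⟨u, v, hu, hv, tapeContent_eq_of_wordMap_eq (hfst hu) (hfst hv) hy hz
      (hyx.trans hzx.symm)⟩

end

theorem gifsEdgeMapD_ofFn {d : ℕ} (M : Fin d → Fin d → ℚ) (v : Fin d → ℚ)
    (x : EuclideanSpace ℝ (Fin d)) (i : Fin d) :
    gifsEdgeMapD d (List.ofFn fun i => List.ofFn (M i)) (List.ofFn v) x i =
      ∑ k, (M i k : ℝ) * x k + v i := by
  simp [gifsEdgeMapD, List.getD_eq_getElem?_getD]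

/-- An edge from `p` to `p'` labelled by the map assigned to the letter `a`. -/
def letterEdge (D p : ℕ) (a : ℕ × Bool) (p' : ℕ) : GifsEdgeD :=
  (p, p', List.ofFn fun i : Fin (D + 1) => List.ofFn fun k : Fin (D + 1) =>
      (if k = i then (if (i : ℕ) = a.1 + 1 then 1 / 16 else 1 / 4) else 0) +
        (if k = 0 then (if (i : ℕ) = a.1 + 1 ∧ a.2 then 1 / 8 else 0) else 0),
    List.ofFn fun _ : Fin (D + 1) => 0)

/-- A loop at the vertex `0` labelled by one of the maps that cut the box. -/
def cubeEdge {D : ℕ} (σ : Fin (D + 1) → Bool) : GifsEdgeD :=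
  (0, 0, List.ofFn fun i : Fin (D + 1) => List.ofFn fun k : Fin (D + 1) =>
      if k = i then 1 / 2 else 0,
    List.ofFn fun i => ((if i = 0 then 10 else 9) + if σ i then 1 else 0) / 2)

theorem gifsEdgeMapD_letterEdge (D p : ℕ) (a : ℕ × Bool) (p' : ℕ) :
    gifsEdgeMapD (D + 1) (letterEdge D p a p').2.2.1 (letterEdge D p a p').2.2.2 =
      letterMap D a := by
  ext x i
  refine (gifsEdgeMapD_ofFn _ _ x i).trans ?_
  rw [letterMap_apply]
  simp only [Rat.cast_add, apply_ite (Rat.cast : ℚ → ℝ), Rat.cast_zero, add_mul,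
    Finset.sum_add_distrib, ite_mul, zero_mul, Finset.sum_ite_eq',
    Finset.mem_univ, if_true, add_zero]
  by_cases h : (i : ℕ) = a.1 + 1 <;> cases a.2 <;> simp [h] <;> ring

theorem gifsEdgeMapD_cubeEdge {D : ℕ} (σ : Fin (D + 1) → Bool) :
    gifsEdgeMapD (D + 1) (cubeEdge σ).2.2.1 (cubeEdge σ).2.2.2 = cubeMap σ := by
  ext x i
  refine (gifsEdgeMapD_ofFn _ _ x i).trans ?_
  simp only [apply_ite (Rat.cast : ℚ → ℝ), Rat.cast_zero, Rat.cast_div, Rat.cast_add, ite_mul,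
    zero_mul, Finset.sum_ite_eq', Finset.mem_univ, if_true, cubeMap]
  push_cast
  ring

theorem gifsWFD_of_mem_iff {D m : ℕ} {E : ℕ → ℕ × Bool → ℕ → Prop} {L : List GifsEdgeD}
    (hL : ∀ e, e ∈ L ↔ (∃ σ : Fin (D + 1) → Bool, e = cubeEdge σ) ∨
      ∃ p a p', E p a p' ∧ e = letterEdge D p a p')
    (hm : 0 < m) (hE : ∀ p a p', E p a p' → p < m ∧ p' < m)
    (h : ∀ p < m, p ≠ 0 → ∃ a p', E p a p') {q r : ℕ} (hq : q < m) (hr : r < m) :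
    GifsWFD (D + 1) m L q r := by
  have half : (1 / 2 : NNReal) < 1 := by
    rw [← NNReal.coe_lt_coe]; norm_num
  refine ⟨hq, hr, fun e he => ?_, fun p hp => ?_⟩
  · rcases (hL e).1 he with ⟨σ, rfl⟩ | ⟨p, a, p', hp, rfl⟩
    · refine ⟨hm, hm, by simp [cubeEdge], by simp [cubeEdge, List.mem_ofFn], by simp [cubeEdge],
        1 / 2, half, ?_⟩
      rw [gifsEdgeMapD_cubeEdge]
      exact lipschitzWith_cubeMap σ
    · refine ⟨(hE _ _ _ hp).1, (hE _ _ _ hp).2, by simp [letterEdge],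
        by simp [letterEdge, List.mem_ofFn], by simp [letterEdge], 1 / 2, half, ?_⟩
      rw [gifsEdgeMapD_letterEdge]
      exact lipschitzWith_letterMap D a
  · rcases eq_or_ne p 0 with rfl | hp0
    · exact ⟨_, (hL _).2 (.inl ⟨fun _ => true, rfl⟩), rfl⟩
    · obtain ⟨a, p', he⟩ := h p hp hp0
      exact ⟨_, (hL _).2 (.inr ⟨p, a, p', he, rfl⟩), rfl⟩

theorem isGifsAttractorD_iff {D m : ℕ} {E : ℕ → ℕ × Bool → ℕ → Prop} {L : List GifsEdgeD}
    (hL : ∀ e, e ∈ L ↔ (∃ σ : Fin (D + 1) → Bool, e = cubeEdge σ) ∨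
      ∃ p a p', E p a p' ∧ e = letterEdge D p a p')
    (hm : 0 < m) (hE : ∀ p a p', E p a p' → p ≠ 0)
    (X : ℕ → Set (EuclideanSpace ℝ (Fin (D + 1)))) :
    IsGifsAttractorD (D + 1) m L X ↔
      (∀ p < m, (X p).Nonempty ∧ IsCompact (X p)) ∧ IsSolution D m E X := by
  have h0 : (⋃ e ∈ L, ⋃ (_ : e.1 = 0), gifsEdgeMapD (D + 1) e.2.2.1 e.2.2.2 '' X e.2.1) =
      ⋃ σ, cubeMap σ '' X 0 := by
    ext x
    simp only [mem_iUnion, exists_prop]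
    constructor
    · rintro ⟨e, he, he0, hx⟩
      rcases (hL e).1 he with ⟨σ, rfl⟩ | ⟨p, a, p', hp, rfl⟩
      · rw [gifsEdgeMapD_cubeEdge] at hx
        exact ⟨σ, hx⟩
      · exact absurd he0 (hE _ _ _ hp)
    · rintro ⟨σ, hx⟩
      refine ⟨_, (hL _).2 (.inl ⟨σ, rfl⟩), rfl, ?_⟩
      rw [gifsEdgeMapD_cubeEdge]
      exact hx
  have hp : ∀ p ≠ 0,
      (⋃ e ∈ L, ⋃ (_ : e.1 = p), gifsEdgeMapD (D + 1) e.2.2.1 e.2.2.2 '' X e.2.1) =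
        ⋃ e ∈ {e : (ℕ × Bool) × ℕ | E p e.1 e.2}, letterMap D e.1 '' X e.2 := by
    intro p hp0
    ext x
    simp only [mem_iUnion, exists_prop]
    constructor
    · rintro ⟨e, he, rfl, hx⟩
      rcases (hL e).1 he with ⟨σ, rfl⟩ | ⟨p, a, p', hE', rfl⟩
      · exact absurd rfl hp0
      · rw [gifsEdgeMapD_letterEdge] at hx
        exact ⟨(a, p'), hE', hx⟩
    · rintro ⟨⟨a, p'⟩, he, hx⟩
      refine ⟨_, (hL _).2 (.inr ⟨p, a, p', he, rfl⟩), rfl, ?_⟩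
      rw [gifsEdgeMapD_letterEdge]
      exact hx
  refine and_congr_right fun _ => ⟨fun h => ⟨?_, fun p hpm hp0 => ?_⟩, fun h p hpm => ?_⟩
  · rw [← h0]
    exact h 0 hm
  · rw [← hp p hp0]
    exact h p hpm
  · rcases eq_or_ne p 0 with rfl | hp0
    · rw [h0]
      exact h.1
    · rw [hp p hp0]
      exact h.2 p hpm hp0

theorem Language.IsRegular.exists_acceptsFrom_eq {α : Type*} {A B : Language α}
    (hA : A.IsRegular) (hB : B.IsRegular) :
    ∃ (k : ℕ) (M : DFA α (Fin k)) (s t : Fin k), M.acceptsFrom s = A ∧ M.acceptsFrom t = B := by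
  obtain ⟨S, _, M, rfl⟩ := hA
  obtain ⟨T, _, N, rfl⟩ := hB
  set e := Fintype.equivFin (S ⊕ T)
  set P : DFA α (Fin (Fintype.card (S ⊕ T))) :=
    { step := fun x a => e ((e.symm x).map (fun s => M.step s a) fun t => N.step t a)
      start := e (.inl M.start)
      accept := {x | (e.symm x).elim (· ∈ M.accept) (· ∈ N.accept)} } with hP
  have hM : ∀ w s, P.evalFrom (e (.inl s)) w = e (.inl (M.evalFrom s w)) := by
    intro w
    induction w with
    | nil => exact fun s => rfl
    | cons a w ih =>
      intro s
      rw [DFA.evalFrom_cons, DFA.evalFrom_cons, ← ih]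
      simp [hP]
  have hN : ∀ w t, P.evalFrom (e (.inr t)) w = e (.inr (N.evalFrom t w)) := by
    intro w
    induction w with
    | nil => exact fun s => rfl
    | cons a w ih =>
      intro s
      rw [DFA.evalFrom_cons, DFA.evalFrom_cons, ← ih]
      simp [hP]
  refine ⟨_, P, e (.inl M.start), e (.inr N.start), ?_, ?_⟩
  · ext w
    rw [DFA.mem_acceptsFrom, hM, DFA.mem_accepts, DFA.eval]
    simp [hP]
  · ext w
    rw [DFA.mem_acceptsFrom, hN, DFA.mem_accepts, DFA.eval]
    simp [hP]

end

/-- The graph of an automaton with states numbered from `1`, all of whose accepting transitions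
also lead to the vertex `0`, extended by a path of length `n + 1` that reads `(1, true)` and ends
in the state `s`. -/
def autEdge {k : ℕ} (M : DFA (ℕ × Bool) (Fin k)) (D : ℕ) (s : Fin k) (n p : ℕ) (a : ℕ × Bool)
    (p' : ℕ) : Prop :=
  (∃ t : Fin k, a.1 < D ∧ p = t + 1 ∧
    (p' = M.step t a + 1 ∨ M.step t a ∈ M.accept ∧ p' = 0)) ∨
  a = (1, true) ∧ (p = k + 1 ∧ p' = s + 1 ∨ ∃ i < n, p = k + 2 + i ∧ p' = k + 1 + i)

section

variable {k D n : ℕ} {M : DFA (ℕ × Bool) (Fin k)} {s : Fin k}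

theorem autEdge_bounds (hD : 1 < D) {p p' : ℕ} {a : ℕ × Bool} (h : autEdge M D s n p a p') :
    (p ≠ 0 ∧ p < k + 2 + n) ∧ a.1 < D ∧ p' < k + 2 + n := by
  rcases h with ⟨t, ha, rfl, rfl | ⟨-, rfl⟩⟩ | ⟨rfl, ⟨rfl, rfl⟩ | ⟨i, hi, rfl, rfl⟩⟩
  · have := (M.step t a).2
    lia
  · lia
  · have := s.2
    lia
  · lia

theorem exists_autEdge (hD : 1 < D) {p : ℕ} (hp : p < k + 2 + n) (hp0 : p ≠ 0) :
    ∃ a p', p' ≠ 0 ∧ autEdge M D s n p a p' := by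
  by_cases h : p < k + 1
  · exact ⟨(0, true), _, Nat.succ_ne_zero _,
      .inl ⟨⟨p - 1, by lia⟩, by lia, by simp; lia, .inl rfl⟩⟩
  · rcases eq_or_ne p (k + 1) with rfl | h1
    · exact ⟨(1, true), _, Nat.succ_ne_zero _, .inr ⟨rfl, .inl ⟨rfl, rfl⟩⟩⟩
    · exact ⟨(1, true), p - 1, by lia, .inr ⟨rfl, .inr ⟨p - (k + 2), by lia, by lia, by lia⟩⟩⟩

theorem autEdge_succ {p p' : ℕ} {a : ℕ × Bool} :
    autEdge M D s n p a p' ↔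
      autEdge M D s 0 p a p' ∨ a = (1, true) ∧ ∃ i < n, p = k + 2 + i ∧ p' = k + 1 + i := by
  simp only [autEdge, Nat.not_lt_zero, false_and, exists_false, or_false, and_or_left, or_assoc]

theorem pathWord_zero_iff (hD : 1 < D) {w : List (ℕ × Bool)} :
    PathWord (autEdge M D s n) 0 w ↔ w = [] := by
  constructor
  · intro h
    cases h with
    | nil => rfl
    | cons h _ => exact absurd rfl (autEdge_bounds hD h).1.1
  · rintro rfl
    exact .nil

theorem pathWord_state_iff (hD : 1 < D) {w : List (ℕ × Bool)} {t : Fin k} :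
    PathWord (autEdge M D s n) (t + 1) w ↔
      w ≠ [] ∧ w ∈ M.acceptsFrom t ∧ ∀ a ∈ w, a.1 < D := by
  induction w generalizing t with
  | nil =>
    simp only [ne_eq, not_true_eq_false, false_and, iff_false]
    exact fun h => nomatch h
  | cons a w ih =>
    have hcons : PathWord (autEdge M D s n) (t + 1) (a :: w) ↔
        ∃ p', autEdge M D s n (t + 1) a p' ∧ PathWord (autEdge M D s n) p' w := by
      constructor
      · rintro (_ | ⟨h, h'⟩)
        exact ⟨_, h, h'⟩
      · rintro ⟨p', h, h'⟩
        exact .cons h h'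
    have hedge : ∀ p', autEdge M D s n (t + 1) a p' ↔
        a.1 < D ∧ (p' = M.step t a + 1 ∨ M.step t a ∈ M.accept ∧ p' = 0) := by
      intro p'
      constructor
      · rintro (⟨t', ha, ht, h⟩ | ⟨-, ⟨h, -⟩ | ⟨i, -, h, -⟩⟩)
        · obtain rfl : t = t' := Fin.ext (by lia)
          exact ⟨ha, h⟩
        · have := t.2
          lia
        · have := t.2
          lia
      · rintro ⟨ha, h⟩
        exact .inl ⟨t, ha, rfl, h⟩
    simp only [hcons, hedge, List.forall_mem_cons, DFA.mem_acceptsFrom, DFA.evalFrom_cons,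
      ne_eq, reduceCtorEq, not_false_eq_true, true_and]
    constructor
    · rintro ⟨p', ⟨ha, rfl | ⟨h, rfl⟩⟩, hw⟩
      · rw [ih] at hw
        exact ⟨hw.2.1, ha, hw.2.2⟩
      · rw [pathWord_zero_iff hD] at hw
        subst hw
        exact ⟨h, ha, by simp⟩
    · rintro ⟨h, ha, hw⟩
      rcases eq_or_ne w [] with rfl | hne
      · exact ⟨0, ⟨ha, .inr ⟨h, rfl⟩⟩, .nil⟩
      · exact ⟨_, ⟨ha, .inl rfl⟩, ih.2 ⟨hne, h, hw⟩⟩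

theorem pathWord_chain_iff {w : List (ℕ × Bool)} {i : ℕ} (hi : i ≤ n) :
    PathWord (autEdge M D s n) (k + 1 + i) w ↔
      ∃ u, w = List.replicate (i + 1) (1, true) ++ u ∧ PathWord (autEdge M D s n) (s + 1) u := by
  induction i generalizing w with
  | zero =>
    constructor
    · rintro (_ | ⟨h, h'⟩)
      rcases h with ⟨t, -, ht, -⟩ | ⟨rfl, ⟨-, rfl⟩ | ⟨i, -, h, -⟩⟩
      · have := t.2
        lia
      · exact ⟨_, rfl, h'⟩
      · lia
    · rintro ⟨u, rfl, h⟩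
      exact .cons (.inr ⟨rfl, .inl ⟨rfl, rfl⟩⟩) h
  | succ i ih =>
    constructor
    · intro h
      generalize hp : k + 1 + (i + 1) = p at h
      cases h with
      | nil => lia
      | cons h h' =>
        rcases h with ⟨t, -, ht, -⟩ | ⟨rfl, ⟨h, -⟩ | ⟨i', -, h, rfl⟩⟩
        · have := t.2
          lia
        · lia
        · obtain rfl : i = i' := by lia
          obtain ⟨u, rfl, hu⟩ := (ih (by lia)).1 h'
          exact ⟨u, rfl, hu⟩
    · rintro ⟨u, rfl, h⟩
      exact .cons (.inr ⟨rfl, .inr ⟨i, by lia, by lia, rfl⟩⟩) ((ih (by lia)).2 ⟨u, rfl, h⟩)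

end

theorem exists_list_edges {k D : ℕ} (hD : 1 < D) (M : DFA (ℕ × Bool) (Fin k)) (s : Fin k) :
    ∃ L₀ : List GifsEdgeD, ∀ n e,
      e ∈ L₀ ++ (List.range n).map (fun i => letterEdge D (k + 2 + i) (1, true) (k + 1 + i)) ↔
        (∃ σ : Fin (D + 1) → Bool, e = cubeEdge σ) ∨
          ∃ p a p', autEdge M D s n p a p' ∧ e = letterEdge D p a p' := by
  have hfin : {e | (∃ σ : Fin (D + 1) → Bool, e = cubeEdge σ) ∨
      ∃ p a p', autEdge M D s 0 p a p' ∧ e = letterEdge D p a p'}.Finite := by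
    refine Set.Finite.union ((Set.finite_range (cubeEdge (D := D))).subset ?_)
      ((((Set.finite_Iio (k + 2)).prod (((Set.finite_Iio D).prod
        (Set.finite_univ (α := Bool))).prod (Set.finite_Iio (k + 2)))).image
          fun x => letterEdge D x.1 x.2.1 x.2.2).subset ?_)
    · rintro _ ⟨σ, rfl⟩
      exact ⟨σ, rfl⟩
    · rintro _ ⟨p, a, p', h, rfl⟩
      obtain ⟨⟨-, h1⟩, h2, h3⟩ := autEdge_bounds hD h
      exact ⟨(p, a, p'), by simp; lia, rfl⟩
  refine ⟨hfin.toFinset.toList, fun n e => ?_⟩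
  simp only [List.mem_append, Finset.mem_toList, Set.Finite.mem_toFinset, Set.mem_ofPred_eq,
    List.mem_map, List.mem_range]
  constructor
  · rintro ((h | ⟨p, a, p', h, rfl⟩) | ⟨i, hi, rfl⟩)
    · exact .inl h
    · exact .inr ⟨p, a, p', autEdge_succ.2 (.inl h), rfl⟩
    · exact .inr ⟨_, _, _, autEdge_succ.2 (.inr ⟨rfl, i, hi, rfl, rfl⟩), rfl⟩
  · rintro (h | ⟨p, a, p', h, rfl⟩)
    · exact .inl (.inl h)
    · rcases autEdge_succ.1 h with h | ⟨rfl, i, hi, rfl, rfl⟩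
      · exact .inl (.inr ⟨p, a, p', h, rfl⟩)
      · exact .inr ⟨i, hi, rfl⟩

theorem computable_instance (D k t : ℕ) (L₀ : List GifsEdgeD) :
    Computable fun n : ℕ => ((D + 1, k + 2 + n,
      L₀ ++ (List.range n).map (fun i => letterEdge D (k + 2 + i) (1, true) (k + 1 + i)),
      k + 1 + n, t) : ℕ × ℕ × List GifsEdgeD × ℕ × ℕ) := by
  have const_add (c : ℕ) : Primrec fun n : ℕ => c + n := Primrec.nat_add.comp (.const c) .id
  have edge : Primrec fun i : ℕ => letterEdge D (k + 2 + i) (1, true) (k + 1 + i) :=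
    (const_add _).pair ((const_add _).pair (.const _))
  have list : Primrec fun n : ℕ =>
      L₀ ++ (List.range n).map (fun i => letterEdge D (k + 2 + i) (1, true) (k + 1 + i)) :=
    Primrec.list_append.comp (.const _)
      (Primrec.list_map Primrec.list_range (edge.comp Primrec.snd).to₂)
  exact ((Primrec.const _).pair ((const_add _).pair
    (list.pair ((const_add _).pair (.const _))))).to_comp

/-- For every partial recursive function, there is a computable family of systems in which the
intersection has empty interior exactly where the function is undefined. -/
theorem exists_computable_gifs_iff_not_dom {f : ℕ →. ℕ} (hf : Partrec f) :
    ∃ inst : ℕ → ℕ × ℕ × List GifsEdgeD × ℕ × ℕ, Computable inst ∧ ∀ n,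
      GifsWFD (inst n).1 (inst n).2.1 (inst n).2.2.1 (inst n).2.2.2.1 (inst n).2.2.2.2 ∧
      ((∀ X : ℕ → Set (EuclideanSpace ℝ (Fin (inst n).1)),
        IsGifsAttractorD (inst n).1 (inst n).2.1 (inst n).2.2.1 X →
          interior (X (inst n).2.2.2.1 ∩ X (inst n).2.2.2.2) = ∅) ↔ ¬ (f n).Dom) := by
  obtain ⟨D, A, B, hD, hA, hB, hA0, hAD, hBD, hAB⟩ :=
    CounterProg.exists_isRegular_tapeContent_eq_iff_dom hf
  obtain ⟨k, M, s, t, rfl, rfl⟩ := hA.exists_acceptsFrom_eq hB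
  obtain ⟨L₀, hL⟩ := exists_list_edges hD M s
  refine ⟨_, computable_instance D k (t + 1) L₀, fun n => ?_⟩
  have hq : k + 1 + n < k + 2 + n := by lia
  have hr : t + 1 < k + 2 + n := by have := t.2; lia
  constructor
  · refine gifsWFD_of_mem_iff (hL n) (by lia)
      (fun p a p' h => ⟨(autEdge_bounds hD h).1.2, (autEdge_bounds hD h).2.2⟩)
      (fun p hp hp0 => ?_) hq hr
    obtain ⟨a, p', -, h⟩ := exists_autEdge (M := M) (s := s) hD hp hp0
    exact ⟨a, p', h⟩
  · simp only [isGifsAttractorD_iff (hL n) (show 0 < k + 2 + n by lia)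
      (fun p a p' h => (autEdge_bounds hD h).1.1), and_imp]
    rw [forall_interior_eq_empty_iff (by lia)
      (fun p a p' h => ⟨(autEdge_bounds hD h).1.1, (autEdge_bounds hD h).2⟩)
      (fun p hp hp0 => exists_autEdge hD hp hp0) hq hr, ← hAB n, not_iff_not]
    constructor
    · rintro ⟨_, v, hu, hv, h⟩
      obtain ⟨u, rfl, hs⟩ := (pathWord_chain_iff le_rfl).1 hu
      exact ⟨u, ((pathWord_state_iff hD).1 hs).2.1, v, ((pathWord_state_iff hD).1 hv).2.1, h⟩
    · rintro ⟨u, hu, v, hv, h⟩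
      refine ⟨_, v, (pathWord_chain_iff le_rfl).2 ⟨u, rfl, (pathWord_state_iff hD).2
        ⟨?_, hu, hAD u hu⟩⟩, (pathWord_state_iff hD).2 ⟨?_, hv, hBD v hv⟩, h⟩
      · rintro rfl
        exact hA0 hu
      · rintro rfl
        simpa [tapeContent, List.replicate_succ] using h 1

/-- It is undecidable, given a `d`-dimensional rational affine GIFS (every vertex having
an outgoing edge) and two distinguished vertices `q`, `r`, whether the intersection
`X_q ∩ X_r` of the corresponding attractor components has empty interior in `ℝ^d`. -/
theorem undecidable_emptyInterior_intersection_gifs :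
    ¬ ∃ f : ℕ × ℕ × List GifsEdgeD × ℕ × ℕ → Bool, Computable f ∧
      ∀ inst : ℕ × ℕ × List GifsEdgeD × ℕ × ℕ,
        GifsWFD inst.1 inst.2.1 inst.2.2.1 inst.2.2.2.1 inst.2.2.2.2 →
        (f inst = true ↔
          ∀ X : ℕ → Set (EuclideanSpace ℝ (Fin inst.1)),
            IsGifsAttractorD inst.1 inst.2.1 inst.2.2.1 X →
            interior (X inst.2.2.2.1 ∩ X inst.2.2.2.2) = ∅) := by
  rintro ⟨f, hf, h⟩
  have hpart : Partrec fun n : ℕ => Nat.Partrec.Code.eval (Denumerable.ofNat _ n) 0 :=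
    Nat.Partrec.Code.eval_part.comp (Computable.ofNat _) (Computable.const 0)
  obtain ⟨inst, hinst, hdom⟩ := exists_computable_gifs_iff_not_dom hpart
  refine ComputablePred.halting_problem 0 (ComputablePred.computable_iff.2
    ⟨fun c => !f (inst (Encodable.encode c)), Primrec.not.to_comp.comp
      (hf.comp (hinst.comp Computable.encode)), funext fun c => propext ?_⟩)
  have := (h _ (hdom (Encodable.encode c)).1).trans (hdom (Encodable.encode c)).2
  rw [Denumerable.ofNat_encode] at this
  cases hc : f (inst (Encodable.encode c)) <;> simp_all
end
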